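/- arXiv:2406.17114 — 6 statements merged into one kernel-verified Lean document; each statement's English description precedes it below -/
import Mathlib

section
/- (Correctness of the attacker's best-response LP.) Let A, B ∈ ℝ^{n×m}, y₁, …, y_K ∈ Δ(m), A' := [Ay₁, …, Ay_K], z* := max_{x∈Δ(n)} min_{j∈[K]} xᵀA y_j, and Π₁* := {x ∈ Δ(n) : xᵀA' e_j ≥ z* for all j ∈ [K]}. Consider the LP: maximize z*·(Σ_{k=1}^K w_k) − α over (y, w, α) ∈ Δ(m) × ℝ^K_{≥0} × ℝ subject to α + (By)ᵢ − (A'w)ᵢ ≥ 0 for all i ∈ [n]. Then this LP has an optimal solution (y*, w*, α*), its optimal value equals V₂* := max_{y∈Δ(m)} min_{x∈Π₁*} xᵀB y, and y* attains this maximin, i.e., min_{x∈Π₁*} xᵀB y* = V₂*. -/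
open Finset

noncomputable section

/-- Expected payoff `xᵀ A y` of mixed strategies `x, y` in a bimatrix game. -/
def pay {n m : ℕ} (A : Matrix (Fin n) (Fin m) ℝ) (x : Fin n → ℝ) (y : Fin m → ℝ) : ℝ :=
  ∑ i, ∑ j, x i * A i j * y j

/-- **Farkas' lemma** for finitely many linear functionals. -/
theorem exists_nonneg_eq_sum_of_forall_nonneg {V ι : Type*} [AddCommGroup V] [Module ℝ V]
    (s : Finset ι) (a : ι → Module.Dual ℝ V) (b : Module.Dual ℝ V)
    (h : ∀ x, (∀ i ∈ s, 0 ≤ a i x) → 0 ≤ b x) :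
    ∃ w : ι → ℝ, (∀ i, 0 ≤ w i) ∧ b = ∑ i ∈ s, w i • a i := by
  classical
  induction s using Finset.induction_on generalizing a b with
  | empty =>
    refine ⟨0, fun _ => le_rfl, ?_⟩
    ext x
    have h₁ := h x (by simp)
    have h₂ := h (-x) (by simp)
    rw [map_neg] at h₂
    simp only [Finset.sum_empty, LinearMap.zero_apply]
    linarith
  | insert j s hj ih =>
    by_cases hb : ∀ x, (∀ i ∈ s, 0 ≤ a i x) → 0 ≤ b x
    · obtain ⟨w, hw, rfl⟩ := ih a b hb
      refine ⟨Function.update w j 0, fun i => ?_, ?_⟩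
      · by_cases hi : i = j
        · subst hi; simp
        · simpa [hi] using hw i
      · rw [Finset.sum_insert hj, Function.update_self, zero_smul, zero_add]
        refine Finset.sum_congr rfl fun i hi => ?_
        rw [Function.update_of_ne (by rintro rfl; exact hj hi)]
    · push Not at hb
      obtain ⟨x₁, hx₁, hbx₁⟩ := hb
      have hj₁ : a j x₁ < 0 := by
        by_contra! hc
        exact hbx₁.not_ge (h x₁ ((Finset.forall_mem_insert _ _ _).2 ⟨hc, hx₁⟩))
      obtain ⟨x₀, hx₀, hbx₀, hj₀⟩ :
          ∃ x₀, (∀ i ∈ s, 0 ≤ a i x₀) ∧ b x₀ < 0 ∧ a j x₀ = -1 := by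
        have hpos : 0 < (-a j x₁)⁻¹ := by simpa using hj₁
        refine ⟨(-a j x₁)⁻¹ • x₁, fun i hi => ?_, ?_, ?_⟩
        · rw [map_smul]
          exact mul_nonneg hpos.le (hx₁ i hi)
        · rw [map_smul]
          exact mul_neg_of_pos_of_neg hpos hbx₁
        · rw [map_smul, smul_eq_mul, inv_neg, neg_mul, inv_mul_cancel₀ hj₁.ne]
      obtain ⟨w, hw, hbw⟩ := ih (fun i => a i + a i x₀ • a j) (b + b x₀ • a j) (by
        intro x hx
        have hy := h (x + a j x • x₀) ((Finset.forall_mem_insert _ _ _).2 ⟨by simp [hj₀], by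
          intro i hi
          simpa [mul_comm] using hx i hi⟩)
        simpa [mul_comm] using hy)
      refine ⟨Function.update w j (∑ i ∈ s, w i * a i x₀ - b x₀), fun i => ?_, ?_⟩
      · by_cases hi : i = j
        · subst hi
          rw [Function.update_self]
          have := Finset.sum_nonneg fun i hi => mul_nonneg (hw i) (hx₀ i hi)
          linarith
        · simpa [hi] using hw i
      · have hsum : ∑ i ∈ s, Function.update w j (∑ i ∈ s, w i * a i x₀ - b x₀) i • a i =
            ∑ i ∈ s, w i • a i := Finset.sum_congr rfl fun i hi => by
          rw [Function.update_of_ne (by rintro rfl; exact hj hi)]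
        rw [Finset.sum_insert hj, Function.update_self, hsum]
        ext x
        have hx := LinearMap.congr_fun hbw x
        simp only [LinearMap.add_apply, LinearMap.smul_apply, LinearMap.sum_apply, smul_eq_mul,
          mul_add, Finset.sum_add_distrib, ← mul_assoc, ← Finset.sum_mul] at hx ⊢
        linarith

theorem pay_eq_dotProduct_mulVec {n m : ℕ} (A : Matrix (Fin n) (Fin m) ℝ) (x : Fin n → ℝ)
    (y : Fin m → ℝ) : pay A x y = x ⬝ᵥ A.mulVec y := by
  simp [pay, dotProduct, Matrix.mulVec, Finset.mul_sum, mul_assoc]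

theorem continuous_pay {n m : ℕ} (A : Matrix (Fin n) (Fin m) ℝ) :
    Continuous fun p : (Fin n → ℝ) × (Fin m → ℝ) => pay A p.1 p.2 := by
  unfold pay
  fun_prop

/-- Weak duality: a dual feasible pair bounds `c` from below on the polytope. -/
theorem dual_value_le_dotProduct {n K : ℕ} (a : Fin K → Fin n → ℝ) (c : Fin n → ℝ) (z α : ℝ)
    (w : Fin K → ℝ) (hw : ∀ k, 0 ≤ w k) (hfeas : ∀ i, 0 ≤ α + c i - ∑ k, a k i * w k)
    (x : Fin n → ℝ) (hx : x ∈ stdSimplex ℝ (Fin n)) (hxa : ∀ k, z ≤ x ⬝ᵥ a k) :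
    z * ∑ k, w k - α ≤ x ⬝ᵥ c := by
  have h₁ : 0 ≤ ∑ i, x i * (α + c i - ∑ k, a k i * w k) :=
    Finset.sum_nonneg fun i _ => mul_nonneg (hx.1 i) (hfeas i)
  have h₂ : ∑ i, x i * (α + c i - ∑ k, a k i * w k) =
      α + x ⬝ᵥ c - ∑ k, w k * (x ⬝ᵥ a k) := by
    simp only [mul_sub, mul_add, Finset.sum_sub_distrib, Finset.sum_add_distrib, dotProduct,
      Finset.mul_sum]
    rw [← Finset.sum_mul, hx.2, one_mul, Finset.sum_comm]
    congr 1
    exact Finset.sum_congr rfl fun _ _ => Finset.sum_congr rfl fun _ _ => by ring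
  have h₃ : z * ∑ k, w k ≤ ∑ k, w k * (x ⬝ᵥ a k) := by
    rw [Finset.mul_sum]
    exact Finset.sum_le_sum fun k _ => by nlinarith [hw k, hxa k]
  linarith

/-- Strong duality: a lower bound for `c` on the polytope is certified by a dual feasible pair. -/
theorem exists_dual_feasible {n K : ℕ} (a : Fin K → Fin n → ℝ) (c : Fin n → ℝ) (z v : ℝ)
    (h : ∀ x ∈ stdSimplex ℝ (Fin n), (∀ k, z ≤ x ⬝ᵥ a k) → v ≤ x ⬝ᵥ c) :
    ∃ (w : Fin K → ℝ) (α : ℝ), (∀ k, 0 ≤ w k) ∧ (∀ i, 0 ≤ α + c i - ∑ k, a k i * w k) ∧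
      z * ∑ k, w k - α = v := by
  let φ : (Fin n → ℝ) → Module.Dual ℝ (Fin n → ℝ) := fun u => dotProductBilin ℝ ℝ u
  have hφ (u : Fin n → ℝ) (t : ℝ) (x : Fin n → ℝ) :
      φ (fun i => u i - t) x = x ⬝ᵥ u - t * ∑ i, x i := by
    simp only [φ, dotProductBilin, LinearMap.coe_mk, AddHom.coe_mk, dotProduct, sub_mul,
      Finset.sum_sub_distrib, Finset.mul_sum, mul_comm (x _)]
  obtain ⟨w, hw, hcw⟩ := exists_nonneg_eq_sum_of_forall_nonneg Finset.univ
    (Sum.elim (fun k => φ (fun i => a k i - z)) (fun i => LinearMap.proj i)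
      : Fin K ⊕ Fin n → Module.Dual ℝ (Fin n → ℝ)) (φ fun i => c i - v) (by
    intro x hx
    have hx₀ (i : Fin n) : 0 ≤ x i := hx (Sum.inr i) (Finset.mem_univ _)
    have hxa (k : Fin K) : 0 ≤ x ⬝ᵥ a k - z * ∑ i, x i := by
      rw [← hφ]
      exact hx (Sum.inl k) (Finset.mem_univ _)
    rw [hφ]
    rcases (Finset.sum_nonneg fun i _ => hx₀ i).eq_or_lt with hS | hS
    · have : x = 0 := by
        funext i
        exact (Finset.sum_eq_zero_iff_of_nonneg fun i _ => hx₀ i).1 hS.symm i (Finset.mem_univ _)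
      simp [this]
    · have hle := h ((∑ i, x i)⁻¹ • x)
        ⟨fun i => mul_nonneg (inv_nonneg.2 hS.le) (hx₀ i), by
          simp [← Finset.mul_sum, hS.ne']⟩ (fun k => by
          rw [smul_dotProduct, smul_eq_mul, inv_mul_eq_div, le_div_iff₀ hS]
          linarith [hxa k])
      rw [smul_dotProduct, smul_eq_mul, inv_mul_eq_div, le_div_iff₀ hS] at hle
      linarith)
  refine ⟨fun k => w (Sum.inl k), z * ∑ k, w (Sum.inl k) - v, fun k => hw _, fun i => ?_, by ring⟩
  have hi := LinearMap.congr_fun hcw (Pi.single i 1)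
  have hsum : ∑ k, w (Sum.inl k) * (a k i - z) =
      ∑ k, a k i * w (Sum.inl k) - z * ∑ k, w (Sum.inl k) := by
    rw [Finset.mul_sum, ← Finset.sum_sub_distrib]
    exact Finset.sum_congr rfl fun _ _ => by ring
  simp [φ, Fintype.sum_sum_type, Pi.single_apply] at hi
  rw [hsum] at hi
  linarith [hw (Sum.inr i)]

/-- correctness of the attacker's best-response LP: the LP
`max z*·(Σ_k w_k) − α` over `(y,w,α) ∈ Δ(m) × ℝ^K_{≥0} × ℝ` with constraints
`α + (By)ᵢ − (A'w)ᵢ ≥ 0, ∀ i`, has an optimal solution `(y*,w*,α*)`; its optimal value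
equals `V₂* = max_{y∈Δ(m)} min_{x∈Π₁*} xᵀ B y`, and `y*` attains this maximin. -/
theorem stmt4 {n m K : ℕ} (hn : 0 < n) (hm : 0 < m) (hK : 0 < K)
    (A B : Matrix (Fin n) (Fin m) ℝ)
    (ys : Fin K → Fin m → ℝ) (hys : ∀ k, ys k ∈ stdSimplex ℝ (Fin m))
    (zstar : ℝ)
    (hz : IsGreatest ((fun x => ⨅ k : Fin K, pay A x (ys k)) '' stdSimplex ℝ (Fin n)) zstar) :
    ∃ (ystar : Fin m → ℝ) (wstar : Fin K → ℝ) (αstar V2star : ℝ),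
      ystar ∈ stdSimplex ℝ (Fin m) ∧
      (∀ k, 0 ≤ wstar k) ∧
      (∀ i : Fin n, 0 ≤ αstar + B.mulVec ystar i - ∑ k, A.mulVec (ys k) i * wstar k) ∧
      IsGreatest {t : ℝ | ∃ y ∈ stdSimplex ℝ (Fin m), ∃ (w : Fin K → ℝ) (α : ℝ),
          (∀ k, 0 ≤ w k) ∧
          (∀ i : Fin n, 0 ≤ α + B.mulVec y i - ∑ k, A.mulVec (ys k) i * w k) ∧
          t = zstar * ∑ k, w k - α}
        (zstar * ∑ k, wstar k - αstar) ∧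
      IsGreatest ((fun y => sInf ((fun x => pay B x y) ''
          {x ∈ stdSimplex ℝ (Fin n) | ∀ k : Fin K, zstar ≤ pay A x (ys k)})) ''
        stdSimplex ℝ (Fin m)) V2star ∧
      zstar * ∑ k, wstar k - αstar = V2star ∧
      sInf ((fun x => pay B x ystar) ''
          {x ∈ stdSimplex ℝ (Fin n) | ∀ k : Fin K, zstar ≤ pay A x (ys k)}) = V2star := by
  set P : Set (Fin n → ℝ) :=
    {x ∈ stdSimplex ℝ (Fin n) | ∀ k : Fin K, zstar ≤ pay A x (ys k)}
  have hpay (M : Matrix (Fin n) (Fin m) ℝ) (y : Fin m → ℝ) :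
      Continuous fun x => pay M x y :=
    (continuous_pay M).comp (f := fun x => (x, y)) (by fun_prop)
  have hPc : IsCompact P := by
    have hPeq : P = stdSimplex ℝ (Fin n) ∩ ⋂ k, {x | zstar ≤ pay A x (ys k)} := by
      ext x
      simp [P]
    rw [hPeq]
    exact (isCompact_stdSimplex ℝ (Fin n)).inter_right
      (isClosed_iInter fun k => isClosed_le continuous_const (hpay A (ys k)))
  have hPne : P.Nonempty := by
    obtain ⟨x, hx, hxz⟩ := hz.1
    exact ⟨x, hx, fun k => hxz ▸ ciInf_le (Set.finite_range _).bddBelow k⟩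
  have hlb (y : Fin m → ℝ) (x : Fin n → ℝ) (hx : x ∈ P) :
      sInf ((fun x => pay B x y) '' P) ≤ pay B x y :=
    csInf_le (hPc.image (hpay B y)).bddBelow ⟨x, hx, rfl⟩
  have hcont : Continuous fun y => sInf ((fun x => pay B x y) '' P) :=
    hPc.continuous_sInf (f := fun y x => pay B x y) ((continuous_pay B).comp continuous_swap)
  obtain ⟨y, hy, hymax⟩ := (isCompact_stdSimplex ℝ (Fin m)).exists_isMaxOn
    ⟨ys ⟨0, hK⟩, hys _⟩ hcont.continuousOn
  obtain ⟨w, α, hw, hfeas, hval⟩ := exists_dual_feasible (fun k => A.mulVec (ys k)) (B.mulVec y)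
    zstar (sInf ((fun x => pay B x y) '' P)) (fun x hx hxa => by
      rw [← pay_eq_dotProduct_mulVec]
      exact hlb y x ⟨hx, fun k => by rw [pay_eq_dotProduct_mulVec]; exact hxa k⟩)
  refine ⟨y, w, α, _, hy, hw, hfeas, ⟨⟨y, hy, w, α, hw, hfeas, rfl⟩, ?_⟩,
    ⟨⟨y, hy, rfl⟩, ?_⟩, hval, rfl⟩
  · rintro _ ⟨y', hy', w', α', hw', hfeas', rfl⟩
    rw [hval]
    refine le_trans (le_csInf (hPne.image _) ?_) (hymax hy')
    rintro _ ⟨x, hx, rfl⟩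
    simp only [pay_eq_dotProduct_mulVec]
    exact dual_value_le_dotProduct (fun k => A.mulVec (ys k)) (B.mulVec y') zstar α' w' hw' hfeas'
      x hx.1 fun k => by rw [← pay_eq_dotProduct_mulVec]; exact hx.2 k
  · rintro _ ⟨y', hy', rfl⟩
    exact hymax hy'
end
end

section
/- (Victim's worst-case Bellman equation.) In a finite-horizon two-player Markov game, let π₂¹, …, π₂ᴷ be base attacker Markov policies and Δ(Π) the set of their per-stage mixings. Define V*_{1,h}(s) := max_{π₁∈Π₁} min_{π₂∈Δ(Π)} V^{π₁,π₂}_{1,h}(s) and Q*_{1,h}(s)[a₁,a₂] := R_{1,h}(s,a₁,a₂) + Σ_{s'} P_h(s'|s,a₁,a₂) V*_{1,h+1}(s'), with V*_{1,H+1} := 0. Then for every h ∈ [H] and s ∈ S: V*_{1,h}(s) = max_{p∈Δ(n)} min_{k∈[K]} Σ_{a₁∈[n]} Σ_{a₂∈[m]} p(a₁) · πᵏ_{2,h}(s)(a₂) · Q*_{1,h}(s)[a₁,a₂]. -/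
open Finset

noncomputable section

/-- Value with `t` steps to go (time step `h = H + 1 - t`, 1-based), defined by the
backward recursion `V_{H+1} = 0`,
`V_h(s) = Σ_{a₁,a₂} π₁ₕ(s)(a₁) π₂ₕ(s)(a₂) [R_h(s,a₁,a₂) + Σ_{s'} P_h(s'|s,a₁,a₂) V_{h+1}(s')]`. -/
def valAux {S : Type} [Fintype S] {n m : ℕ} (H : ℕ)
    (R : ℕ → S → Fin n → Fin m → ℝ) (P : ℕ → S → Fin n → Fin m → S → ℝ)
    (π1 : ℕ → S → Fin n → ℝ) (π2 : ℕ → S → Fin m → ℝ) : ℕ → S → ℝ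
  | 0, _ => 0
  | t + 1, s =>
      ∑ a1, ∑ a2, π1 (H - t) s a1 * π2 (H - t) s a2 *
        (R (H - t) s a1 a2 + ∑ s', P (H - t) s a1 a2 s' * valAux H R P π1 π2 t s')

/-- The value `V^{π₁,π₂}_h(s)` at (1-based) time step `h ∈ [H+1]`. -/
def Vfun {S : Type} [Fintype S] {n m : ℕ} (H : ℕ)
    (R : ℕ → S → Fin n → Fin m → ℝ) (P : ℕ → S → Fin n → Fin m → S → ℝ)
    (π1 : ℕ → S → Fin n → ℝ) (π2 : ℕ → S → Fin m → ℝ) (h : ℕ) (s : S) : ℝ :=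
  valAux H R P π1 π2 (H + 1 - h) s

/-- The set of Markov policies over action set `[n]`. -/
def polSet (S : Type) (n : ℕ) : Set (ℕ → S → Fin n → ℝ) :=
  {π | ∀ h s, π h s ∈ stdSimplex ℝ (Fin n)}

/-- The belief set `Δ(Π)`: all attacker Markov policies that are, at every stage and
state, a convex combination of the base policies `π₂¹, …, π₂ᴷ`. -/
def beliefSet (S : Type) {m K : ℕ} (base : Fin K → ℕ → S → Fin m → ℝ) :
    Set (ℕ → S → Fin m → ℝ) :=
  {π | ∀ h s, ∃ p ∈ stdSimplex ℝ (Fin K), ∀ a2, π h s a2 = ∑ k, p k * base k h s a2}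

/-- `P` is a transition kernel: each `P_h(·|s,a₁,a₂)` is a probability distribution. -/
def isKernel (S : Type) [Fintype S] {n m : ℕ} (P : ℕ → S → Fin n → Fin m → S → ℝ) : Prop :=
  ∀ h s a1 a2, (fun s' => P h s a1 a2 s') ∈ stdSimplex ℝ S

/-- The victim's optimal worst-case value `V*_{1,h}(s) = max_{π₁} min_{π₂∈Δ(Π)} V^{π₁,π₂}_{1,h}(s)`. -/
def Vstar1 {S : Type} [Fintype S] {n m K : ℕ} (H : ℕ)
    (R1 : ℕ → S → Fin n → Fin m → ℝ) (P : ℕ → S → Fin n → Fin m → S → ℝ)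
    (base : Fin K → ℕ → S → Fin m → ℝ) (h : ℕ) (s : S) : ℝ :=
  sSup ((fun π1 => sInf ((fun π2 => Vfun H R1 P π1 π2 h s) '' beliefSet S base)) '' polSet S n)

/-- The expected payoff of the bimatrix entry table `Q` under the mixed actions `p` and `q`. -/
def mixedPayoff {n m : ℕ} (p : Fin n → ℝ) (q : Fin m → ℝ) (Q : Fin n → Fin m → ℝ) : ℝ :=
  ∑ a1, ∑ a2, p a1 * q a2 * Q a1 a2

theorem mixedPayoff_mono {n m : ℕ} {p : Fin n → ℝ} {q : Fin m → ℝ}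
    (hp : ∀ a, 0 ≤ p a) (hq : ∀ a, 0 ≤ q a) {Q Q' : Fin n → Fin m → ℝ}
    (hQ : ∀ a1 a2, Q a1 a2 ≤ Q' a1 a2) : mixedPayoff p q Q ≤ mixedPayoff p q Q' :=
  Finset.sum_le_sum fun a1 _ => Finset.sum_le_sum fun a2 _ =>
    mul_le_mul_of_nonneg_left (hQ a1 a2) (mul_nonneg (hp a1) (hq a2))

theorem mixedPayoff_const {n m : ℕ} {p : Fin n → ℝ} {q : Fin m → ℝ}
    (hp : ∑ a, p a = 1) (hq : ∑ a, q a = 1) (c : ℝ) :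
    mixedPayoff p q (fun _ _ => c) = c := by
  simp only [mixedPayoff, ← Finset.sum_mul, ← Finset.mul_sum, hp, hq, one_mul]

theorem mixedPayoff_sum_right {n m K : ℕ} (p : Fin n → ℝ) (w : Fin K → ℝ)
    (b : Fin K → Fin m → ℝ) (Q : Fin n → Fin m → ℝ) :
    mixedPayoff p (fun a2 => ∑ k, w k * b k a2) Q = ∑ k, w k * mixedPayoff p (b k) Q := by
  simp only [mixedPayoff, Finset.mul_sum, Finset.sum_mul]
  rw [Finset.sum_comm]
  conv_rhs => rw [Finset.sum_comm]
  rw [Finset.sum_comm]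
  refine Finset.sum_congr rfl fun a1 _ => ?_
  rw [Finset.sum_comm]
  exact Finset.sum_congr rfl fun k _ => Finset.sum_congr rfl fun a2 _ => by ring

theorem iInf_mixedPayoff_le_of_mem_stdSimplex {n m K : ℕ} (p : Fin n → ℝ) {w : Fin K → ℝ}
    (hw : w ∈ stdSimplex ℝ (Fin K)) (b : Fin K → Fin m → ℝ) (Q : Fin n → Fin m → ℝ) :
    ⨅ k, mixedPayoff p (b k) Q ≤ mixedPayoff p (fun a2 => ∑ k, w k * b k a2) Q := by
  rw [mixedPayoff_sum_right]
  calc ⨅ k, mixedPayoff p (b k) Q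
      = ∑ k, w k * ⨅ k, mixedPayoff p (b k) Q := by rw [← Finset.sum_mul, hw.2, one_mul]
    _ ≤ _ := Finset.sum_le_sum fun k _ => mul_le_mul_of_nonneg_left
        (ciInf_le (Set.finite_range _).bddBelow k) (hw.1 k)

theorem exists_isMaxOn_iInf_mixedPayoff {n m K : ℕ} (hn : 0 < n) (hK : 0 < K)
    (b : Fin K → Fin m → ℝ) (Q : Fin n → Fin m → ℝ) :
    ∃ p ∈ stdSimplex ℝ (Fin n),
      IsMaxOn (fun p => ⨅ k, mixedPayoff p (b k) Q) (stdSimplex ℝ (Fin n)) p := by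
  have : Nonempty (Fin K) := ⟨⟨0, hK⟩⟩
  refine (isCompact_stdSimplex ℝ (Fin n)).exists_isMaxOn
    ⟨_, single_mem_stdSimplex ℝ (⟨0, hn⟩ : Fin n)⟩ (Continuous.continuousOn ?_)
  simp only [← Finset.inf'_univ_eq_ciInf]
  refine Continuous.finset_inf'_apply _ fun k _ => ?_
  unfold mixedPayoff
  fun_prop

/-- The payoff table at step `h`, state `s`, when the continuation value is `V`. -/
def stageGame {S : Type} [Fintype S] {n m : ℕ} (R : ℕ → S → Fin n → Fin m → ℝ)
    (P : ℕ → S → Fin n → Fin m → S → ℝ) (V : S → ℝ) (h : ℕ) (s : S)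
    (a1 : Fin n) (a2 : Fin m) : ℝ :=
  R h s a1 a2 + ∑ s', P h s a1 a2 s' * V s'

theorem stageGame_mono {S : Type} [Fintype S] {n m : ℕ} (R : ℕ → S → Fin n → Fin m → ℝ)
    {P : ℕ → S → Fin n → Fin m → S → ℝ} (hP : isKernel S P) {V V' : S → ℝ}
    (hV : ∀ s, V s ≤ V' s) (h : ℕ) (s : S) (a1 : Fin n) (a2 : Fin m) :
    stageGame R P V h s a1 a2 ≤ stageGame R P V' h s a1 a2 := by
  unfold stageGame
  gcongr with s' _
  exacts [(hP h s a1 a2).1 s', hV s']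

theorem valAux_succ {S : Type} [Fintype S] {n m : ℕ} (H : ℕ)
    (R : ℕ → S → Fin n → Fin m → ℝ) (P : ℕ → S → Fin n → Fin m → S → ℝ)
    (π1 : ℕ → S → Fin n → ℝ) (π2 : ℕ → S → Fin m → ℝ) (t : ℕ) (s : S) :
    valAux H R P π1 π2 (t + 1) s =
      mixedPayoff (π1 (H - t) s) (π2 (H - t) s)
        (stageGame R P (valAux H R P π1 π2 t) (H - t) s) := rfl

/-- The solution, with `t` steps to go, of the victim's worst-case Bellman recursion. -/
def robustValue {S : Type} [Fintype S] {n m K : ℕ} (H : ℕ)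
    (R : ℕ → S → Fin n → Fin m → ℝ) (P : ℕ → S → Fin n → Fin m → S → ℝ)
    (base : Fin K → ℕ → S → Fin m → ℝ) : ℕ → S → ℝ
  | 0, _ => 0
  | t + 1, s =>
      sSup ((fun p => ⨅ k, mixedPayoff p (base k (H - t) s)
        (stageGame R P (robustValue H R P base t) (H - t) s)) '' stdSimplex ℝ (Fin n))

theorem isGreatest_robustValue {S : Type} [Fintype S] {n m K : ℕ} (hn : 0 < n) (hK : 0 < K)
    (H : ℕ) (R : ℕ → S → Fin n → Fin m → ℝ) (P : ℕ → S → Fin n → Fin m → S → ℝ)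
    (base : Fin K → ℕ → S → Fin m → ℝ) (t : ℕ) (s : S) :
    IsGreatest ((fun p => ⨅ k, mixedPayoff p (base k (H - t) s)
        (stageGame R P (robustValue H R P base t) (H - t) s)) '' stdSimplex ℝ (Fin n))
      (robustValue H R P base (t + 1) s) := by
  obtain ⟨p, hp, hmax⟩ := exists_isMaxOn_iInf_mixedPayoff hn hK
    (fun k => base k (H - t) s) (stageGame R P (robustValue H R P base t) (H - t) s)
  rw [robustValue]
  set g : (Fin n → ℝ) → ℝ := fun p => ⨅ k, mixedPayoff p (base k (H - t) s)
    (stageGame R P (robustValue H R P base t) (H - t) s)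
  have hg : IsGreatest (g '' stdSimplex ℝ (Fin n)) (g p) :=
    ⟨Set.mem_image_of_mem g hp, Set.forall_mem_image.2 fun _ hq => hmax hq⟩
  exact hg.csSup_eq.symm ▸ hg

theorem mem_polSet_of_mem_beliefSet {S : Type} {m K : ℕ} {base : Fin K → ℕ → S → Fin m → ℝ}
    (hbase : ∀ k, base k ∈ polSet S m) {π2 : ℕ → S → Fin m → ℝ}
    (hπ2 : π2 ∈ beliefSet S base) : π2 ∈ polSet S m := by
  intro h s
  obtain ⟨w, hw, e⟩ := hπ2 h s
  have e' : π2 h s = ∑ k, w k • base k h s := by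
    ext a
    simp [e a]
  rw [e']
  exact (convex_stdSimplex ℝ (Fin m)).sum_mem (fun k _ => hw.1 k) hw.2
    fun k _ => hbase k h s

theorem exists_le_valAux {S : Type} [Fintype S] {n m : ℕ} (H : ℕ)
    (R : ℕ → S → Fin n → Fin m → ℝ) {P : ℕ → S → Fin n → Fin m → S → ℝ} (hP : isKernel S P)
    (t : ℕ) :
    ∃ c : ℝ, ∀ π1 ∈ polSet S n, ∀ π2 ∈ polSet S m, ∀ s, c ≤ valAux H R P π1 π2 t s := by
  induction t with
  | zero => exact ⟨0, fun _ _ _ _ _ => le_rfl⟩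
  | succ t ih =>
    obtain ⟨c, hc⟩ := ih
    obtain ⟨r, hr⟩ := (Set.finite_range fun x : S × Fin n × Fin m =>
      stageGame R P (fun _ => c) (H - t) x.1 x.2.1 x.2.2).bddBelow
    refine ⟨r, fun π1 h1 π2 h2 s => ?_⟩
    rw [valAux_succ, ← mixedPayoff_const (h1 (H - t) s).2 (h2 (H - t) s).2 r]
    exact mixedPayoff_mono (h1 _ s).1 (h2 _ s).1 fun a1 a2 =>
      (hr ⟨(s, a1, a2), rfl⟩).trans (stageGame_mono R hP (hc π1 h1 π2 h2) _ s a1 a2)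

theorem exists_robustValue_le_valAux {S : Type} [Fintype S] {n m K : ℕ} (hn : 0 < n)
    (hK : 0 < K) (H : ℕ) (R : ℕ → S → Fin n → Fin m → ℝ)
    {P : ℕ → S → Fin n → Fin m → S → ℝ} (hP : isKernel S P)
    {base : Fin K → ℕ → S → Fin m → ℝ} (hbase : ∀ k, base k ∈ polSet S m) :
    ∃ π1 ∈ polSet S n, ∀ π2 ∈ beliefSet S base, ∀ t ≤ H, ∀ s,
      robustValue H R P base t s ≤ valAux H R P π1 π2 t s := by
  choose π1 hπ1 hmax using fun h s => exists_isMaxOn_iInf_mixedPayoff hn hK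
    (fun k => base k h s) (stageGame R P (robustValue H R P base (H - h)) h s)
  refine ⟨π1, hπ1, fun π2 h2 t => ?_⟩
  induction t with
  | zero => exact fun _ _ => le_rfl
  | succ t ih =>
    intro ht s
    obtain ⟨p, hp, e⟩ := (isGreatest_robustValue hn hK H R P base t s).1
    obtain ⟨w, hw, ew⟩ := h2 (H - t) s
    have hmax' := hmax (H - t) s hp
    rw [Nat.sub_sub_self (by omega : t ≤ H)] at hmax'
    rw [← e, valAux_succ]
    refine le_trans hmax' ((iInf_mixedPayoff_le_of_mem_stdSimplex _ hw _ _).trans ?_)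
    rw [← funext ew]
    exact mixedPayoff_mono (hπ1 _ s).1 (mem_polSet_of_mem_beliefSet hbase h2 _ s).1
      (stageGame_mono R hP (ih (by omega)) _ s)

theorem exists_valAux_le_robustValue {S : Type} [Fintype S] {n m K : ℕ} (hn : 0 < n)
    (hK : 0 < K) (H : ℕ) (R : ℕ → S → Fin n → Fin m → ℝ)
    {P : ℕ → S → Fin n → Fin m → S → ℝ} (hP : isKernel S P)
    {base : Fin K → ℕ → S → Fin m → ℝ} (hbase : ∀ k, base k ∈ polSet S m)
    {π1 : ℕ → S → Fin n → ℝ} (hπ1 : π1 ∈ polSet S n) :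
    ∃ π2 ∈ beliefSet S base, ∀ t ≤ H, ∀ s,
      valAux H R P π1 π2 t s ≤ robustValue H R P base t s := by
  have : Nonempty (Fin K) := ⟨⟨0, hK⟩⟩
  choose κ hκ using fun h s => exists_eq_ciInf_of_finite (f := fun k =>
    mixedPayoff (π1 h s) (base k h s) (stageGame R P (robustValue H R P base (H - h)) h s))
  refine ⟨fun h s => base (κ h s) h s,
    fun h s => ⟨Pi.single (κ h s) 1, single_mem_stdSimplex ℝ _, fun a => ?_⟩, fun t => ?_⟩
  · simp [Pi.single_apply]
  · induction t with
    | zero => exact fun _ _ => le_rfl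
    | succ t ih =>
      intro ht s
      have hκ' := hκ (H - t) s
      rw [Nat.sub_sub_self (by omega : t ≤ H)] at hκ'
      rw [valAux_succ]
      exact (mixedPayoff_mono (hπ1 _ s).1 (hbase _ _ s).1
        (stageGame_mono R hP (ih (by omega)) _ s)).trans (hκ'.le.trans
          ((isGreatest_robustValue hn hK H R P base t s).2 ⟨_, hπ1 (H - t) s, rfl⟩))

theorem Vstar1_eq_robustValue {S : Type} [Fintype S] {n m K : ℕ} (hn : 0 < n)
    (hK : 0 < K) (H : ℕ) (R : ℕ → S → Fin n → Fin m → ℝ)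
    {P : ℕ → S → Fin n → Fin m → S → ℝ} (hP : isKernel S P)
    {base : Fin K → ℕ → S → Fin m → ℝ} (hbase : ∀ k, base k ∈ polSet S m)
    {h : ℕ} (hh : 1 ≤ h) (s : S) :
    Vstar1 H R P base h s = robustValue H R P base (H + 1 - h) s := by
  have upper : ∀ π1 ∈ polSet S n,
      sInf ((fun π2 => Vfun H R P π1 π2 h s) '' beliefSet S base) ≤
        robustValue H R P base (H + 1 - h) s := by
    intro π1 h1
    obtain ⟨c, hc⟩ := exists_le_valAux H R hP (H + 1 - h)
    obtain ⟨π2, h2, hle⟩ := exists_valAux_le_robustValue hn hK H R hP hbase h1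
    refine (csInf_le ⟨c, ?_⟩ (Set.mem_image_of_mem _ h2)).trans (hle _ (by omega) s)
    rintro _ ⟨π2', h2', rfl⟩
    exact hc π1 h1 π2' (mem_polSet_of_mem_beliefSet hbase h2') s
  obtain ⟨π1, h1, hge⟩ := exists_robustValue_le_valAux hn hK H R hP hbase
  obtain ⟨π2, h2, -⟩ := exists_valAux_le_robustValue hn hK H R hP hbase h1
  refine IsGreatest.csSup_eq ⟨⟨π1, h1, le_antisymm (upper π1 h1) ?_⟩,
    Set.forall_mem_image.2 upper⟩
  refine le_csInf ⟨_, π2, h2, rfl⟩ ?_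
  rintro _ ⟨π2', h2', rfl⟩
  exact hge π2' h2' _ (by omega) s

/-- victim's worst-case Bellman equation: for every `h ∈ [H]` and `s`,
`V*_{1,h}(s) = max_{p∈Δ(n)} min_{k∈[K]} Σ_{a₁,a₂} p(a₁) πᵏ_{2,h}(s)(a₂) Q*_{1,h}(s)[a₁,a₂]`,
where `Q*_{1,h}(s)[a₁,a₂] = R_{1,h}(s,a₁,a₂) + Σ_{s'} P_h(s'|s,a₁,a₂) V*_{1,h+1}(s')`. -/
theorem stmt7 {S : Type} [Fintype S] {n m K H : ℕ} (hn : 0 < n) (hm : 0 < m) (hK : 0 < K)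
    (R1 : ℕ → S → Fin n → Fin m → ℝ)
    (P : ℕ → S → Fin n → Fin m → S → ℝ) (hP : isKernel S P)
    (base : Fin K → ℕ → S → Fin m → ℝ) (hbase : ∀ k, base k ∈ polSet S m)
    (h : ℕ) (hh1 : 1 ≤ h) (hhH : h ≤ H) (s : S) :
    IsGreatest
      ((fun p : Fin n → ℝ => ⨅ k : Fin K, ∑ a1, ∑ a2, p a1 * base k h s a2 *
          (R1 h s a1 a2 + ∑ s', P h s a1 a2 s' * Vstar1 H R1 P base (h + 1) s')) ''
        stdSimplex ℝ (Fin n))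
      (Vstar1 H R1 P base h s) := by
  have key := isGreatest_robustValue hn hK H R1 P base (H - h) s
  rw [Nat.sub_sub_self hhH, ← Nat.sub_add_comm hhH] at key
  simp only [Vstar1_eq_robustValue hn hK H R1 hP hbase (by omega : 1 ≤ h + 1),
    Vstar1_eq_robustValue hn hK H R1 hP hbase hh1, Nat.add_sub_add_right]
  exact key
end
end

section
/- (Existence of a Markov-perfect robust victim best response.) In a finite-horizon two-player Markov game with base attacker Markov policies π₂¹, …, π₂ᴷ and belief set Δ(Π), define V*_{1,h}(s) := max_{π₁∈Π₁} min_{π₂∈Δ(Π)} V^{π₁,π₂}_{1,h}(s). Then there exists a victim Markov policy π₁* such that for every h ∈ [H] and s ∈ S simultaneously, min_{π₂∈Δ(Π)} V^{π₁*,π₂}_{1,h}(s) = V*_{1,h}(s). -/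
open Finset

noncomputable section

/-- The expected one-stage payoff at step `h` and state `s`, with continuation value `W`, when the
players use the mixed actions `x` and `q`. -/
def stageVal {S : Type} [Fintype S] {n m : ℕ}
    (R : ℕ → S → Fin n → Fin m → ℝ) (P : ℕ → S → Fin n → Fin m → S → ℝ)
    (h : ℕ) (s : S) (W : S → ℝ) (x : Fin n → ℝ) (q : Fin m → ℝ) : ℝ :=
  ∑ a1, ∑ a2, x a1 * q a2 * (R h s a1 a2 + ∑ s', P h s a1 a2 s' * W s')

/-- The worst one-stage payoff of `x` against the base attacker policies. -/
def robustStage {S : Type} [Fintype S] {n m K : ℕ} [Nonempty (Fin K)]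
    (R : ℕ → S → Fin n → Fin m → ℝ) (P : ℕ → S → Fin n → Fin m → S → ℝ)
    (base : Fin K → ℕ → S → Fin m → ℝ) (h : ℕ) (s : S) (W : S → ℝ) (x : Fin n → ℝ) : ℝ :=
  Finset.univ.inf' Finset.univ_nonempty fun k => stageVal R P h s W x (base k h s)

/-- The worst-case value of `π1` with `t` steps to go, computed by backward recursion. -/
def robustVal {S : Type} [Fintype S] {n m K : ℕ} [Nonempty (Fin K)] (H : ℕ)
    (R : ℕ → S → Fin n → Fin m → ℝ) (P : ℕ → S → Fin n → Fin m → S → ℝ)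
    (base : Fin K → ℕ → S → Fin m → ℝ) (π1 : ℕ → S → Fin n → ℝ) : ℕ → S → ℝ
  | 0, _ => 0
  | t + 1, s =>
      robustStage R P base (H - t) s (robustVal H R P base π1 t) (π1 (H - t) s)

/-- The value with `t` steps to go of playing the mixed actions `opt h s W`, where `W` is the
worst-case continuation value. -/
def greedyVal {S : Type} [Fintype S] {n m K : ℕ} [Nonempty (Fin K)] (H : ℕ)
    (R : ℕ → S → Fin n → Fin m → ℝ) (P : ℕ → S → Fin n → Fin m → S → ℝ)
    (base : Fin K → ℕ → S → Fin m → ℝ) (opt : ℕ → S → (S → ℝ) → Fin n → ℝ) : ℕ → S → ℝ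
  | 0, _ => 0
  | t + 1, s =>
      robustStage R P base (H - t) s (greedyVal H R P base opt t)
        (opt (H - t) s (greedyVal H R P base opt t))

theorem beliefSet_subset_polSet {S : Type} {m K : ℕ} {base : Fin K → ℕ → S → Fin m → ℝ}
    (hbase : ∀ k, base k ∈ polSet S m) :
    beliefSet S base ⊆ polSet S m := by
  intro π hπ h s
  obtain ⟨p, hp, hpe⟩ := hπ h s
  refine ⟨fun a => ?_, ?_⟩
  · rw [hpe]
    exact Finset.sum_nonneg fun k _ => mul_nonneg (hp.1 k) ((hbase k h s).1 a)
  · simp only [hpe]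
    rw [Finset.sum_comm]
    simp only [← Finset.mul_sum, (hbase _ h s).2, mul_one, hp.2]

section

variable {S : Type} [Fintype S] {n m K : ℕ} {R : ℕ → S → Fin n → Fin m → ℝ}
  {P : ℕ → S → Fin n → Fin m → S → ℝ} {base : Fin K → ℕ → S → Fin m → ℝ}

theorem stageVal_mono (hP : isKernel S P) {h : ℕ} {s : S} {W W' : S → ℝ} (hW : ∀ s', W s' ≤ W' s')
    {x : Fin n → ℝ} (hx : x ∈ stdSimplex ℝ (Fin n)) {q : Fin m → ℝ}
    (hq : q ∈ stdSimplex ℝ (Fin m)) :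
    stageVal R P h s W x q ≤ stageVal R P h s W' x q := by
  unfold stageVal
  refine Finset.sum_le_sum fun a1 _ => Finset.sum_le_sum fun a2 _ => ?_
  refine mul_le_mul_of_nonneg_left ?_ (mul_nonneg (hx.1 a1) (hq.1 a2))
  refine add_le_add le_rfl (Finset.sum_le_sum fun s' _ => ?_)
  exact mul_le_mul_of_nonneg_left (hW s') ((hP h s a1 a2).1 s')

theorem stageVal_mixture (h : ℕ) (s : S) (W : S → ℝ) (x : Fin n → ℝ) {q : Fin m → ℝ}
    {p : Fin K → ℝ} {b : Fin K → Fin m → ℝ} (hq : ∀ a2, q a2 = ∑ k, p k * b k a2) :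
    stageVal R P h s W x q = ∑ k, p k * stageVal R P h s W x (b k) := by
  unfold stageVal
  simp only [hq, Finset.mul_sum, Finset.sum_mul]
  rw [Finset.sum_comm_cycle]
  refine Finset.sum_congr rfl fun k _ => Finset.sum_congr rfl fun a1 _ =>
    Finset.sum_congr rfl fun a2 _ => ?_
  ring

theorem continuous_stageVal (h : ℕ) (s : S) (W : S → ℝ) (q : Fin m → ℝ) :
    Continuous fun x : Fin n → ℝ => stageVal R P h s W x q := by
  unfold stageVal
  fun_prop

variable [Nonempty (Fin K)]

theorem robustStage_mono (hP : isKernel S P) (hbase : ∀ k, base k ∈ polSet S m) {h : ℕ} {s : S}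
    {W W' : S → ℝ} (hW : ∀ s', W s' ≤ W' s') {x : Fin n → ℝ} (hx : x ∈ stdSimplex ℝ (Fin n)) :
    robustStage R P base h s W x ≤ robustStage R P base h s W' x := by
  refine Finset.le_inf' _ _ fun k hk => ?_
  exact (Finset.inf'_le _ hk).trans (stageVal_mono hP hW hx (hbase k h s))

theorem robustStage_le_stageVal {π2 : ℕ → S → Fin m → ℝ} (hπ2 : π2 ∈ beliefSet S base)
    (h : ℕ) (s : S) (W : S → ℝ) (x : Fin n → ℝ) :
    robustStage R P base h s W x ≤ stageVal R P h s W x (π2 h s) := by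
  obtain ⟨p, hp, hpe⟩ := hπ2 h s
  rw [stageVal_mixture h s W x hpe]
  calc robustStage R P base h s W x = ∑ k, p k * robustStage R P base h s W x := by
        rw [← Finset.sum_mul, hp.2, one_mul]
    _ ≤ _ := Finset.sum_le_sum fun k hk =>
        mul_le_mul_of_nonneg_left (Finset.inf'_le _ hk) (hp.1 k)

theorem exists_robustStage_maximizer (hn : 0 < n) (h : ℕ) (s : S) (W : S → ℝ) :
    ∃ x ∈ stdSimplex ℝ (Fin n), ∀ y ∈ stdSimplex ℝ (Fin n),
      robustStage R P base h s W y ≤ robustStage R P base h s W x := by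
  have hcont : Continuous fun x : Fin n → ℝ => robustStage R P base h s W x :=
    Continuous.finset_inf'_apply _ fun k _ => continuous_stageVal h s W (base k h s)
  exact (isCompact_stdSimplex ℝ (Fin n)).exists_isMaxOn
    ⟨_, single_mem_stdSimplex ℝ (⟨0, hn⟩ : Fin n)⟩ hcont.continuousOn

theorem robustVal_le_valAux {H : ℕ} (hP : isKernel S P) (hbase : ∀ k, base k ∈ polSet S m)
    {π1 : ℕ → S → Fin n → ℝ} (hπ1 : π1 ∈ polSet S n) {π2 : ℕ → S → Fin m → ℝ}
    (hπ2 : π2 ∈ beliefSet S base) (t : ℕ) (s : S) :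
    robustVal H R P base π1 t s ≤ valAux H R P π1 π2 t s := by
  induction t generalizing s with
  | zero => exact le_rfl
  | succ t ih =>
    exact (robustStage_le_stageVal hπ2 _ _ _ _).trans
      (stageVal_mono hP ih (hπ1 _ _) (beliefSet_subset_polSet hbase hπ2 _ _))

theorem exists_valAux_eq_robustVal (H : ℕ) (R : ℕ → S → Fin n → Fin m → ℝ)
    (P : ℕ → S → Fin n → Fin m → S → ℝ) (base : Fin K → ℕ → S → Fin m → ℝ)
    (π1 : ℕ → S → Fin n → ℝ) :
    ∃ π2 ∈ beliefSet S base, ∀ t ≤ H, ∀ s,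
      valAux H R P π1 π2 t s = robustVal H R P base π1 t s := by
  have hmin : ∀ h s, ∃ k : Fin K,
      robustStage R P base h s (robustVal H R P base π1 (H - h)) (π1 h s) =
        stageVal R P h s (robustVal H R P base π1 (H - h)) (π1 h s) (base k h s) := by
    intro h s
    obtain ⟨k, -, hk⟩ := Finset.exists_mem_eq_inf' (Finset.univ_nonempty (α := Fin K))
      fun k => stageVal R P h s (robustVal H R P base π1 (H - h)) (π1 h s) (base k h s)
    exact ⟨k, hk⟩
  choose k hk using hmin
  refine ⟨fun h s => base (k h s) h s, fun h s => ?_, fun t => ?_⟩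
  · exact ⟨_, single_mem_stdSimplex ℝ (k h s), fun a2 => by simp [Pi.single_apply]⟩
  · induction t with
    | zero => exact fun _ _ => rfl
    | succ t ih =>
      intro ht s
      have hW := funext (ih (by omega))
      have hs := hk (H - t) s
      rw [Nat.sub_sub_self (by omega : t ≤ H)] at hs
      change stageVal R P (H - t) s _ _ _ = robustStage R P base (H - t) s _ _
      rw [hW, hs]

theorem robustVal_le_greedyVal {H : ℕ} (hP : isKernel S P) (hbase : ∀ k, base k ∈ polSet S m)
    {opt : ℕ → S → (S → ℝ) → Fin n → ℝ}
    (hopt : ∀ h s W, ∀ y ∈ stdSimplex ℝ (Fin n),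
      robustStage R P base h s W y ≤ robustStage R P base h s W (opt h s W))
    {π1 : ℕ → S → Fin n → ℝ} (hπ1 : π1 ∈ polSet S n) (t : ℕ) (s : S) :
    robustVal H R P base π1 t s ≤ greedyVal H R P base opt t s := by
  induction t generalizing s with
  | zero => exact le_rfl
  | succ t ih =>
    exact (robustStage_mono hP hbase ih (hπ1 _ _)).trans (hopt _ _ _ _ (hπ1 _ _))

theorem robustVal_greedy {H : ℕ} (opt : ℕ → S → (S → ℝ) → Fin n → ℝ) {t : ℕ} (ht : t ≤ H) (s : S) :
    robustVal H R P base (fun h s => opt h s (greedyVal H R P base opt (H - h))) t s =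
      greedyVal H R P base opt t s := by
  induction t generalizing s with
  | zero => rfl
  | succ t ih =>
    have hW := funext (ih (by omega))
    simp only [robustVal, greedyVal, hW, Nat.sub_sub_self (by omega : t ≤ H)]

theorem sInf_Vfun_eq_robustVal {H : ℕ} (hP : isKernel S P) (hbase : ∀ k, base k ∈ polSet S m)
    {π1 : ℕ → S → Fin n → ℝ} (hπ1 : π1 ∈ polSet S n) {h : ℕ} (hh : 1 ≤ h) (s : S) :
    sInf ((fun π2 => Vfun H R P π1 π2 h s) '' beliefSet S base) =
      robustVal H R P base π1 (H + 1 - h) s := by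
  refine IsLeast.csInf_eq ⟨?_, ?_⟩
  · obtain ⟨π2, hπ2, hval⟩ := exists_valAux_eq_robustVal H R P base π1
    exact ⟨π2, hπ2, hval _ (by omega) s⟩
  · rintro _ ⟨π2, hπ2, rfl⟩
    exact robustVal_le_valAux hP hbase hπ1 hπ2 _ s

end

/-- existence of a Markov-perfect robust victim best response: there is a
victim Markov policy `π₁*` such that simultaneously for every `h ∈ [H]` and `s ∈ S`,
`min_{π₂∈Δ(Π)} V^{π₁*,π₂}_{1,h}(s) = V*_{1,h}(s)`. -/
theorem stmt8 {S : Type} [Fintype S] {n m K H : ℕ} (hn : 0 < n) (hm : 0 < m) (hK : 0 < K)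
    (R1 : ℕ → S → Fin n → Fin m → ℝ)
    (P : ℕ → S → Fin n → Fin m → S → ℝ) (hP : isKernel S P)
    (base : Fin K → ℕ → S → Fin m → ℝ) (hbase : ∀ k, base k ∈ polSet S m) :
    ∃ π1star ∈ polSet S n, ∀ h : ℕ, 1 ≤ h → h ≤ H → ∀ s : S,
      sInf ((fun π2 => Vfun H R1 P π1star π2 h s) '' beliefSet S base)
        = Vstar1 H R1 P base h s := by
  have : Nonempty (Fin K) := ⟨⟨0, hK⟩⟩
  choose opt hmem hopt using exists_robustStage_maximizer (R := R1) (P := P) (base := base) hn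
  have hstar : (fun h s => opt h s (greedyVal H R1 P base opt (H - h))) ∈ polSet S n :=
    fun _ _ => hmem _ _ _
  refine ⟨_, hstar, fun h hh _ s => Eq.symm ?_⟩
  refine IsGreatest.csSup_eq ⟨⟨_, hstar, rfl⟩, ?_⟩
  rintro _ ⟨π1, hπ1, rfl⟩
  simp only [sInf_Vfun_eq_robustVal hP hbase hstar hh, sInf_Vfun_eq_robustVal hP hbase hπ1 hh]
  rw [robustVal_greedy opt (by omega)]
  exact robustVal_le_greedyVal hP hbase hopt hπ1 _ s
end
end

section
/- (Attacker's worst-case Bellman equation.) In a finite-horizon two-player Markov game with base attacker Markov policies π₂¹, …, π₂ᴷ and belief set Δ(Π), define V*_{1,h}(s) := max_{π₁∈Π₁} min_{π₂∈Δ(Π)} V^{π₁,π₂}_{1,h}(s); Π₁* := {π₁ ∈ Π₁ : min_{π₂∈Δ(Π)} V^{π₁,π₂}_{1,h}(s) = V*_{1,h}(s) for all h ∈ [H], s ∈ S}; V*_{2,h}(s) := max_{π₂∈Π₂} min_{π₁∈Π₁*} V^{π₁,π₂}_{2,h}(s); and Q*_{i,h}(s)[a₁,a₂] := R_{i,h}(s,a₁,a₂)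 + Σ_{s'} P_h(s'|s,a₁,a₂) V*_{i,h+1}(s') with V*_{i,H+1} := 0. Let B*_h(s) := {p ∈ Δ(n) : Σ_{a₁,a₂} p(a₁) πᵏ_{2,h}(s)(a₂) Q*_{1,h}(s)[a₁,a₂] ≥ V*_{1,h}(s) for all k ∈ [K]}. Then for every h ∈ [H] and s ∈ S: V*_{2,h}(s) = max_{q∈Δ(m)} min_{p∈B*_h(s)} Σ_{a₁,a₂} p(a₁) q(a₂) Q*_{2,h}(s)[a₁,a₂]. -/
open Finset

noncomputable section

/-- The set `Π₁*` of victim policies that achieve the optimal worst-case value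
`V*_{1,h}(s)` simultaneously at every `h ∈ [H]` and `s ∈ S`. -/
def Pi1starSet {S : Type} [Fintype S] {n m K : ℕ} (H : ℕ)
    (R1 : ℕ → S → Fin n → Fin m → ℝ) (P : ℕ → S → Fin n → Fin m → S → ℝ)
    (base : Fin K → ℕ → S → Fin m → ℝ) : Set (ℕ → S → Fin n → ℝ) :=
  {π1 ∈ polSet S n | ∀ h : ℕ, 1 ≤ h → h ≤ H → ∀ s : S,
    sInf ((fun π2 => Vfun H R1 P π1 π2 h s) '' beliefSet S base) = Vstar1 H R1 P base h s}

/-- The attacker's optimal worst-case value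
`V*_{2,h}(s) = max_{π₂∈Π₂} min_{π₁∈Π₁*} V^{π₁,π₂}_{2,h}(s)`. -/
def Vstar2 {S : Type} [Fintype S] {n m K : ℕ} (H : ℕ)
    (R1 R2 : ℕ → S → Fin n → Fin m → ℝ) (P : ℕ → S → Fin n → Fin m → S → ℝ)
    (base : Fin K → ℕ → S → Fin m → ℝ) (h : ℕ) (s : S) : ℝ :=
  sSup ((fun π2 => sInf ((fun π1 => Vfun H R2 P π1 π2 h s) '' Pi1starSet H R1 P base)) ''
    polSet S m)

/-- The worst-case one-stage payoff of the maximizer's choice `p`, with continuation `v`. -/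
def stageInf {S X Y : Type} (G : ℕ → S → X → Y → (S → ℝ) → ℝ) (C : ℕ → S → Set Y)
    (h : ℕ) (s : S) (p : X) (v : S → ℝ) : ℝ :=
  sInf ((fun q => G h s p q v) '' C h s)

/-- The value of a pair of policies with `t` steps to go, for one-stage payoffs `G`. -/
def gameValue {S X Y : Type} (H : ℕ) (G : ℕ → S → X → Y → (S → ℝ) → ℝ)
    (π : ℕ → S → X) (σ : ℕ → S → Y) : ℕ → S → ℝ
  | 0, _ => 0
  | t + 1, s => G (H - t) s (π (H - t) s) (σ (H - t) s) (gameValue H G π σ t)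

/-- The worst-case value of the policy `π`, by backward recursion. -/
def worstValue {S X Y : Type} (H : ℕ) (G : ℕ → S → X → Y → (S → ℝ) → ℝ)
    (C : ℕ → S → Set Y) (π : ℕ → S → X) : ℕ → S → ℝ
  | 0, _ => 0
  | t + 1, s => stageInf G C (H - t) s (π (H - t) s) (worstValue H G C π t)

/-- The optimal worst-case value, by backward recursion. -/
def maxminValue {S X Y : Type} (H : ℕ) (G : ℕ → S → X → Y → (S → ℝ) → ℝ)
    (A : ℕ → S → Set X) (C : ℕ → S → Set Y) : ℕ → S → ℝ
  | 0, _ => 0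
  | t + 1, s =>
      sSup ((fun p => stageInf G C (H - t) s p (maxminValue H G A C t)) '' A (H - t) s)

/-- The policies whose choice at each stage and state lies in a prescribed set. -/
def rectSet {S X : Type} (A : ℕ → S → Set X) : Set (ℕ → S → X) :=
  {π | ∀ h s, π h s ∈ A h s}

/-- One-stage payoffs that are jointly continuous in the choices and monotone in the
continuation, over compact nonempty choice sets. -/
structure RegularGame {S X Y : Type} [TopologicalSpace X] [TopologicalSpace Y]
    (G : ℕ → S → X → Y → (S → ℝ) → ℝ) (A : ℕ → S → Set X) (C : ℕ → S → Set Y) : Prop where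
  compact_left : ∀ h s, IsCompact (A h s)
  nonempty_left : ∀ h s, (A h s).Nonempty
  compact_right : ∀ h s, IsCompact (C h s)
  nonempty_right : ∀ h s, (C h s).Nonempty
  continuous_payoff : ∀ h s v, Continuous fun x : X × Y => G h s x.1 x.2 v
  mono_payoff : ∀ h s, ∀ p ∈ A h s, ∀ q ∈ C h s, Monotone (G h s p q)

namespace RegularGame

variable {S X Y : Type} [TopologicalSpace X] [TopologicalSpace Y]
  {G : ℕ → S → X → Y → (S → ℝ) → ℝ} {A : ℕ → S → Set X} {C : ℕ → S → Set Y}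

theorem isLeast_stageInf (hG : RegularGame G A C) (h : ℕ) (s : S) (p : X) (v : S → ℝ) :
    IsLeast ((fun q => G h s p q v) '' C h s) (stageInf G C h s p v) :=
  ((hG.compact_right h s).image
    ((hG.continuous_payoff h s v).comp (Continuous.prodMk_right p))).isLeast_sInf
    ((hG.nonempty_right h s).image _)

theorem stageInf_le (hG : RegularGame G A C) {h : ℕ} {s : S} (p : X) {q : Y}
    (hq : q ∈ C h s) (v : S → ℝ) : stageInf G C h s p v ≤ G h s p q v :=
  (hG.isLeast_stageInf h s p v).2 ⟨q, hq, rfl⟩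

theorem exists_stageInf_eq (hG : RegularGame G A C) (h : ℕ) (s : S) (p : X) (v : S → ℝ) :
    ∃ q ∈ C h s, G h s p q v = stageInf G C h s p v :=
  (hG.isLeast_stageInf h s p v).1

theorem stageInf_mono (hG : RegularGame G A C) {h : ℕ} {s : S} {p : X} (hp : p ∈ A h s) :
    Monotone (stageInf G C h s p) := by
  intro v w hvw
  obtain ⟨q, hq, hqw⟩ := hG.exists_stageInf_eq h s p w
  rw [← hqw]
  exact (hG.stageInf_le p hq v).trans (hG.mono_payoff h s p hp q hq hvw)

theorem isGreatest_maxminValue_succ (hG : RegularGame G A C) (H t : ℕ) (s : S) :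
    IsGreatest ((fun p => stageInf G C (H - t) s p (maxminValue H G A C t)) '' A (H - t) s)
      (maxminValue H G A C (t + 1) s) := by
  refine ((hG.compact_left _ s).image ?_).isGreatest_sSup ((hG.nonempty_left _ s).image _)
  exact (hG.compact_right _ s).continuous_sInf (hG.continuous_payoff _ s _)

theorem worstValue_le_gameValue (hG : RegularGame G A C) (H : ℕ) {π : ℕ → S → X}
    (hπ : π ∈ rectSet A) {σ : ℕ → S → Y} (hσ : σ ∈ rectSet C) (t : ℕ) :
    worstValue H G C π t ≤ gameValue H G π σ t := by
  induction t with
  | zero => exact fun _ => le_rfl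
  | succ t ih =>
    exact fun s => (hG.stageInf_le _ (hσ _ s) _).trans
      (hG.mono_payoff _ s _ (hπ _ s) _ (hσ _ s) ih)

theorem exists_gameValue_eq_worstValue (hG : RegularGame G A C) (H : ℕ) (π : ℕ → S → X) :
    ∃ σ ∈ rectSet C, ∀ t ≤ H + 1, gameValue H G π σ t = worstValue H G C π t := by
  choose σ hσ hval using fun h s =>
    hG.exists_stageInf_eq h s (π h s) (worstValue H G C π (H - h))
  refine ⟨σ, hσ, fun t => ?_⟩
  induction t with
  | zero => exact fun _ => rfl
  | succ t ih =>
    intro ht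
    funext s
    have := hval (H - t) s
    rw [Nat.sub_sub_self (by omega)] at this
    rw [gameValue, ih (by omega), this, worstValue]

theorem sInf_gameValue (hG : RegularGame G A C) {H : ℕ} {π : ℕ → S → X}
    (hπ : π ∈ rectSet A) {t : ℕ} (ht : t ≤ H + 1) (s : S) :
    sInf ((fun σ => gameValue H G π σ t s) '' rectSet C) = worstValue H G C π t s := by
  obtain ⟨σ, hσ, hval⟩ := hG.exists_gameValue_eq_worstValue H π
  refine IsLeast.csInf_eq ⟨⟨σ, hσ, by rw [← hval t ht]⟩, ?_⟩
  rintro _ ⟨σ', hσ', rfl⟩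
  exact hG.worstValue_le_gameValue H hπ hσ' t s

theorem worstValue_le_maxminValue (hG : RegularGame G A C) (H : ℕ) {π : ℕ → S → X}
    (hπ : π ∈ rectSet A) (t : ℕ) : worstValue H G C π t ≤ maxminValue H G A C t := by
  induction t with
  | zero => exact fun _ => le_rfl
  | succ t ih =>
    exact fun s => (hG.stageInf_mono (hπ _ s) ih).trans
      ((hG.isGreatest_maxminValue_succ H t s).2 ⟨_, hπ _ s, rfl⟩)

theorem exists_worstValue_eq_maxminValue (hG : RegularGame G A C) (H : ℕ) :
    ∃ π ∈ rectSet A, ∀ t ≤ H + 1, worstValue H G C π t = maxminValue H G A C t := by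
  have hmax : ∀ h s, ∃ p ∈ A h s, h ≤ H → stageInf G C h s p (maxminValue H G A C (H - h)) =
      maxminValue H G A C (H - h + 1) s := by
    intro h s
    by_cases hh : h ≤ H
    · obtain ⟨p, hp, hval⟩ := (hG.isGreatest_maxminValue_succ H (H - h) s).1
      rw [Nat.sub_sub_self hh] at hp
      refine ⟨p, hp, fun _ => ?_⟩
      rw [← hval, Nat.sub_sub_self hh]
    · obtain ⟨p, hp⟩ := hG.nonempty_left h s
      exact ⟨p, hp, fun h' => absurd h' hh⟩
  choose π hπ hval using hmax
  refine ⟨π, hπ, fun t => ?_⟩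
  induction t with
  | zero => exact fun _ => rfl
  | succ t ih =>
    intro ht
    funext s
    have := hval (H - t) s (Nat.sub_le _ _)
    rw [Nat.sub_sub_self (by omega)] at this
    rw [worstValue, ih (by omega), this]

theorem sSup_sInf_gameValue (hG : RegularGame G A C) {H t : ℕ} (ht : t ≤ H + 1) (s : S) :
    sSup ((fun π => sInf ((fun σ => gameValue H G π σ t s) '' rectSet C)) '' rectSet A) =
      maxminValue H G A C t s := by
  obtain ⟨π, hπ, hval⟩ := hG.exists_worstValue_eq_maxminValue H
  refine IsGreatest.csSup_eq ⟨⟨π, hπ, ?_⟩, ?_⟩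
  · rw [← hval t ht]
    exact hG.sInf_gameValue hπ ht s
  · rintro _ ⟨π', hπ', rfl⟩
    exact (hG.sInf_gameValue hπ' ht s).trans_le (hG.worstValue_le_maxminValue H hπ' t s)

/-- A policy attains the optimal worst-case value at every stage `1, …, H` iff each of its
choices there is optimal in the one-stage problem with the optimal continuation. -/
theorem worstValue_eq_maxminValue_iff (hG : RegularGame G A C) {H : ℕ} {π : ℕ → S → X}
    (hπ : π ∈ rectSet A) :
    (∀ h, 1 ≤ h → h ≤ H → ∀ s,
      worstValue H G C π (H + 1 - h) s = maxminValue H G A C (H + 1 - h) s) ↔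
    ∀ h, 1 ≤ h → h ≤ H → ∀ s, maxminValue H G A C (H + 1 - h) s ≤
      stageInf G C h s (π h s) (maxminValue H G A C (H - h)) := by
  constructor
  · intro hopt h h1 hH s
    have hnext : worstValue H G C π (H - h) = maxminValue H G A C (H - h) := by
      obtain rfl | hlt := hH.eq_or_lt
      · rw [Nat.sub_self]
        rfl
      · funext s'
        simpa using hopt (h + 1) (by omega) (by omega) s'
    rw [← hopt h h1 hH s, Nat.succ_sub hH, worstValue, Nat.sub_sub_self hH, hnext]
  · intro hopt
    have key : ∀ t ≤ H, worstValue H G C π t = maxminValue H G A C t := by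
      intro t
      induction t with
      | zero => exact fun _ => rfl
      | succ t ih =>
        intro ht
        refine le_antisymm (hG.worstValue_le_maxminValue H hπ _) fun s => ?_
        have := hopt (H - t) (by omega) (by omega) s
        rw [Nat.succ_sub (Nat.sub_le _ _), Nat.sub_sub_self (by omega)] at this
        rwa [worstValue, ih (by omega)]
    intro h h1 hH s
    rw [key _ (by omega)]

end RegularGame

/-- The one-stage expected payoff of mixed actions `p`, `q` with continuation `v`. -/
def stagePayoff {S : Type} [Fintype S] {n m : ℕ} (R : ℕ → S → Fin n → Fin m → ℝ)
    (P : ℕ → S → Fin n → Fin m → S → ℝ) (h : ℕ) (s : S) (p : Fin n → ℝ) (q : Fin m → ℝ)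
    (v : S → ℝ) : ℝ :=
  ∑ a1, ∑ a2, p a1 * q a2 * (R h s a1 a2 + ∑ s', P h s a1 a2 s' * v s')

/-- The mixed actions that are convex combinations of the base policies at a given stage. -/
def beliefHull {S : Type} {m K : ℕ} (base : Fin K → ℕ → S → Fin m → ℝ) (h : ℕ) (s : S) :
    Set (Fin m → ℝ) :=
  (fun (w : Fin K → ℝ) a2 => ∑ k, w k * base k h s a2) '' stdSimplex ℝ (Fin K)

section Payoff

variable {S : Type} [Fintype S] {n m K : ℕ} (R : ℕ → S → Fin n → Fin m → ℝ)
  {P : ℕ → S → Fin n → Fin m → S → ℝ}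

theorem continuous_stagePayoff (P : ℕ → S → Fin n → Fin m → S → ℝ) (h : ℕ) (s : S)
    (v : S → ℝ) :
    Continuous fun x : (Fin n → ℝ) × (Fin m → ℝ) => stagePayoff R P h s x.1 x.2 v := by
  unfold stagePayoff
  fun_prop

theorem stagePayoff_mono (hP : isKernel S P) (h : ℕ) (s : S) {p : Fin n → ℝ}
    (hp : p ∈ stdSimplex ℝ (Fin n)) {q : Fin m → ℝ} (hq : q ∈ stdSimplex ℝ (Fin m)) :
    Monotone (stagePayoff R P h s p q) := by
  intro v w hvw
  refine sum_le_sum fun a1 _ => sum_le_sum fun a2 _ =>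
    mul_le_mul_of_nonneg_left ?_ (mul_nonneg (hp.1 a1) (hq.1 a2))
  gcongr with s' _
  · exact (hP h s a1 a2).1 s'
  · exact hvw s'

theorem stagePayoff_sum_right (P : ℕ → S → Fin n → Fin m → S → ℝ) (h : ℕ) (s : S)
    (p : Fin n → ℝ) (w : Fin K → ℝ) (q : Fin K → Fin m → ℝ) (v : S → ℝ) :
    stagePayoff R P h s p (fun a2 => ∑ k, w k * q k a2) v =
      ∑ k, w k * stagePayoff R P h s p (q k) v := by
  simp only [stagePayoff]
  calc
    _ = ∑ a1, ∑ a2, ∑ k, w k * (p a1 * q k a2 * (R h s a1 a2 + ∑ s', P h s a1 a2 s' * v s')) := ?_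
    _ = ∑ a1, ∑ k, ∑ a2, w k * (p a1 * q k a2 * (R h s a1 a2 + ∑ s', P h s a1 a2 s' * v s')) :=
      sum_congr rfl fun _ _ => sum_comm
    _ = ∑ k, ∑ a1, ∑ a2, w k * (p a1 * q k a2 * (R h s a1 a2 + ∑ s', P h s a1 a2 s' * v s')) :=
      sum_comm
    _ = _ := by simp_rw [← mul_sum]
  refine sum_congr rfl fun a1 _ => sum_congr rfl fun a2 _ => ?_
  rw [mul_sum, sum_mul]
  exact sum_congr rfl fun k _ => by ring

theorem valAux_eq_gameValue (P : ℕ → S → Fin n → Fin m → S → ℝ) (H : ℕ)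
    (π1 : ℕ → S → Fin n → ℝ) (π2 : ℕ → S → Fin m → ℝ) (t : ℕ) :
    valAux H R P π1 π2 t = gameValue H (stagePayoff R P) π1 π2 t := by
  induction t with
  | zero => rfl
  | succ t ih =>
    funext s
    rw [valAux, ih]
    rfl

theorem valAux_eq_gameValue_swap (P : ℕ → S → Fin n → Fin m → S → ℝ) (H : ℕ)
    (π1 : ℕ → S → Fin n → ℝ) (π2 : ℕ → S → Fin m → ℝ) (t : ℕ) :
    valAux H R P π1 π2 t =
      gameValue H (fun h s q p v => stagePayoff R P h s p q v) π2 π1 t := by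
  induction t with
  | zero => rfl
  | succ t ih =>
    funext s
    rw [valAux, ih]
    rfl

end Payoff

theorem stdSimplex_fin_nonempty {n : ℕ} (hn : 0 < n) : (stdSimplex ℝ (Fin n)).Nonempty :=
  ⟨_, single_mem_stdSimplex ℝ (⟨0, hn⟩ : Fin n)⟩

section Belief

variable {S : Type} {m K : ℕ} {base : Fin K → ℕ → S → Fin m → ℝ}

theorem base_mem_beliefHull (k : Fin K) (h : ℕ) (s : S) : base k h s ∈ beliefHull base h s := by
  refine ⟨Pi.single k 1, single_mem_stdSimplex ℝ k, ?_⟩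
  funext a2
  simp [Pi.single_apply]

theorem isCompact_beliefHull (base : Fin K → ℕ → S → Fin m → ℝ) (h : ℕ) (s : S) :
    IsCompact (beliefHull base h s) :=
  (isCompact_stdSimplex ℝ (Fin K)).image (by fun_prop)

theorem beliefHull_subset (hbase : ∀ k, base k ∈ polSet S m) (h : ℕ) (s : S) :
    beliefHull base h s ⊆ stdSimplex ℝ (Fin m) := by
  rintro _ ⟨w, hw, rfl⟩
  refine ⟨fun a2 => sum_nonneg fun k _ => mul_nonneg (hw.1 k) ((hbase k h s).1 a2), ?_⟩
  rw [sum_comm]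
  simp_rw [← mul_sum, (hbase _ h s).2, mul_one]
  exact hw.2

theorem beliefSet_eq_rectSet (base : Fin K → ℕ → S → Fin m → ℝ) :
    beliefSet S base = rectSet (beliefHull base) := by
  ext π
  refine forall₂_congr fun h s => exists_congr fun w => and_congr_right fun _ => ?_
  rw [funext_iff]
  exact forall_congr' fun _ => eq_comm

end Belief

/-- The victim's one-stage choices guaranteeing at least `c` against every base policy. -/
def safeSet {S : Type} [Fintype S] {n m K : ℕ} (R : ℕ → S → Fin n → Fin m → ℝ)
    (P : ℕ → S → Fin n → Fin m → S → ℝ) (base : Fin K → ℕ → S → Fin m → ℝ)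
    (h : ℕ) (s : S) (v : S → ℝ) (c : ℝ) : Set (Fin n → ℝ) :=
  {p ∈ stdSimplex ℝ (Fin n) | ∀ k, c ≤ stagePayoff R P h s p (base k h s) v}

section Safe

variable {S : Type} [Fintype S] {n m K : ℕ} (R : ℕ → S → Fin n → Fin m → ℝ)
  {P : ℕ → S → Fin n → Fin m → S → ℝ} {base : Fin K → ℕ → S → Fin m → ℝ}

theorem isCompact_safeSet (P : ℕ → S → Fin n → Fin m → S → ℝ)
    (base : Fin K → ℕ → S → Fin m → ℝ) (h : ℕ) (s : S) (v : S → ℝ) (c : ℝ) :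
    IsCompact (safeSet R P base h s v c) := by
  refine (isCompact_stdSimplex ℝ (Fin n)).inter_right
    (t := {p | ∀ k, c ≤ stagePayoff R P h s p (base k h s) v}) ?_
  rw [Set.ofPred_forall]
  exact isClosed_iInter fun k => isClosed_le continuous_const
    ((continuous_stagePayoff R P h s v).comp (Continuous.prodMk_left _))

theorem regularGame_victim (hn : 0 < n) (hK : 0 < K) (hP : isKernel S P)
    (hbase : ∀ k, base k ∈ polSet S m) :
    RegularGame (stagePayoff R P) (fun _ _ => stdSimplex ℝ (Fin n)) (beliefHull base) where
  compact_left _ _ := isCompact_stdSimplex ℝ _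
  nonempty_left _ _ := stdSimplex_fin_nonempty hn
  compact_right := isCompact_beliefHull base
  nonempty_right h s := ⟨_, base_mem_beliefHull ⟨0, hK⟩ h s⟩
  continuous_payoff := continuous_stagePayoff R P
  mono_payoff h s _ hp _ hq := stagePayoff_mono R hP h s hp (beliefHull_subset hbase h s hq)

theorem mem_safeSet_iff (hn : 0 < n) (hK : 0 < K) (hP : isKernel S P)
    (hbase : ∀ k, base k ∈ polSet S m) {h : ℕ} {s : S} {v : S → ℝ} {c : ℝ} {p : Fin n → ℝ}
    (hp : p ∈ stdSimplex ℝ (Fin n)) :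
    p ∈ safeSet R P base h s v c ↔ c ≤ stageInf (stagePayoff R P) (beliefHull base) h s p v := by
  have hG := regularGame_victim R hn hK hP hbase
  constructor
  · intro hsafe
    obtain ⟨_, ⟨w, hw, rfl⟩, hval⟩ := hG.exists_stageInf_eq h s p v
    rw [← hval, stagePayoff_sum_right]
    calc c = ∑ k, w k * c := by rw [← sum_mul, hw.2, one_mul]
      _ ≤ _ := sum_le_sum fun k _ => mul_le_mul_of_nonneg_left (hsafe.2 k) (hw.1 k)
  · exact fun hc => ⟨hp, fun k => hc.trans (hG.stageInf_le p (base_mem_beliefHull k h s) v)⟩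

theorem Vstar1_eq_maxminValue (hn : 0 < n) (hK : 0 < K) (hP : isKernel S P)
    (hbase : ∀ k, base k ∈ polSet S m) {H h : ℕ} (s : S) :
    Vstar1 H R P base h s = maxminValue H (stagePayoff R P)
      (fun _ _ => stdSimplex ℝ (Fin n)) (beliefHull base) (H + 1 - h) s := by
  rw [← (regularGame_victim R hn hK hP hbase).sSup_sInf_gameValue (Nat.sub_le _ _) s,
    ← beliefSet_eq_rectSet]
  simp only [Vstar1, Vfun, valAux_eq_gameValue]
  rfl

end Safe

/-- The victim's choices at each stage that keep a policy optimal in the worst case; stages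
outside `1, …, H` are unconstrained. -/
def optimalChoices {S : Type} [Fintype S] {n m K : ℕ} (H : ℕ) (R : ℕ → S → Fin n → Fin m → ℝ)
    (P : ℕ → S → Fin n → Fin m → S → ℝ) (base : Fin K → ℕ → S → Fin m → ℝ)
    (h : ℕ) (s : S) : Set (Fin n → ℝ) :=
  if 1 ≤ h ∧ h ≤ H then safeSet R P base h s (Vstar1 H R P base (h + 1)) (Vstar1 H R P base h s)
  else stdSimplex ℝ (Fin n)

section Optimal

variable {S : Type} [Fintype S] {n m K H : ℕ} {R : ℕ → S → Fin n → Fin m → ℝ}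
  {P : ℕ → S → Fin n → Fin m → S → ℝ} {base : Fin K → ℕ → S → Fin m → ℝ}

theorem optimalChoices_subset (h : ℕ) (s : S) :
    optimalChoices H R P base h s ⊆ stdSimplex ℝ (Fin n) := by
  unfold optimalChoices
  split_ifs
  · exact fun p hp => hp.1
  · exact subset_rfl

theorem Pi1starSet_eq_rectSet (hn : 0 < n) (hK : 0 < K) (hP : isKernel S P)
    (hbase : ∀ k, base k ∈ polSet S m) :
    Pi1starSet H R P base = rectSet (optimalChoices H R P base) := by
  have hG := regularGame_victim R hn hK hP hbase
  have hV : ∀ h, Vstar1 H R P base h = maxminValue H (stagePayoff R P)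
      (fun _ _ => stdSimplex ℝ (Fin n)) (beliefHull base) (H + 1 - h) :=
    fun h => funext fun s => Vstar1_eq_maxminValue R hn hK hP hbase s
  ext π
  have hiff : π ∈ polSet S n → ((∀ h : ℕ, 1 ≤ h → h ≤ H → ∀ s : S,
      sInf ((fun π2 => Vfun H R P π π2 h s) '' beliefSet S base) = Vstar1 H R P base h s) ↔
      ∀ h s, π h s ∈ optimalChoices H R P base h s) := by
    intro hπ
    have hW : ∀ h s, sInf ((fun π2 => Vfun H R P π π2 h s) '' beliefSet S base) =
        worstValue H (stagePayoff R P) (beliefHull base) π (H + 1 - h) s := by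
      intro h s
      rw [← hG.sInf_gameValue hπ (Nat.sub_le _ _) s, ← beliefSet_eq_rectSet]
      simp only [Vfun, valAux_eq_gameValue]
    simp_rw [hW, hV]
    rw [hG.worstValue_eq_maxminValue_iff hπ]
    refine forall_congr' fun h => ?_
    by_cases hh : 1 ≤ h ∧ h ≤ H
    · simp only [optimalChoices, hh.1, hh.2, true_imp_iff, and_self, if_true, hV,
        mem_safeSet_iff R hn hK hP hbase (hπ h _), Nat.add_sub_add_right]
    · simp only [optimalChoices, if_neg hh, hπ h _, implies_true, iff_true]
      exact fun h1 h2 => absurd ⟨h1, h2⟩ hh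
  exact ⟨fun h => (hiff h.1).1 h.2, fun h =>
    have hpol : π ∈ polSet S n := fun t s => optimalChoices_subset t s (h t s)
    ⟨hpol, (hiff hpol).2 h⟩⟩

theorem optimalChoices_nonempty (hn : 0 < n) (hK : 0 < K) (hP : isKernel S P)
    (hbase : ∀ k, base k ∈ polSet S m) (h : ℕ) (s : S) :
    (optimalChoices H R P base h s).Nonempty := by
  have hG := regularGame_victim R hn hK hP hbase
  obtain ⟨π, hπ, hval⟩ := hG.exists_worstValue_eq_maxminValue H
  have hmem : π ∈ Pi1starSet H R P base := by
    refine ⟨hπ, fun h _ _ s => ?_⟩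
    rw [Vstar1_eq_maxminValue R hn hK hP hbase, ← hval _ (Nat.sub_le _ _),
      ← hG.sInf_gameValue hπ (Nat.sub_le _ _) s, ← beliefSet_eq_rectSet]
    simp only [Vfun, valAux_eq_gameValue]
  rw [Pi1starSet_eq_rectSet hn hK hP hbase] at hmem
  exact ⟨_, hmem h s⟩

theorem regularGame_attacker (hn : 0 < n) (hm : 0 < m) (hK : 0 < K) (hP : isKernel S P)
    (hbase : ∀ k, base k ∈ polSet S m) (R2 : ℕ → S → Fin n → Fin m → ℝ) :
    RegularGame (fun h s q p v => stagePayoff R2 P h s p q v)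
      (fun _ _ => stdSimplex ℝ (Fin m)) (optimalChoices H R P base) where
  compact_left _ _ := isCompact_stdSimplex ℝ _
  nonempty_left _ _ := stdSimplex_fin_nonempty hm
  compact_right h s := by
    unfold optimalChoices
    split_ifs
    · exact isCompact_safeSet R P base h s _ _
    · exact isCompact_stdSimplex ℝ _
  nonempty_right := optimalChoices_nonempty hn hK hP hbase
  continuous_payoff h s v := (continuous_stagePayoff R2 P h s v).comp continuous_swap
  mono_payoff h s _ hq _ hp := stagePayoff_mono R2 hP h s (optimalChoices_subset h s hp) hq

theorem Vstar2_eq_maxminValue (hn : 0 < n) (hm : 0 < m) (hK : 0 < K) (hP : isKernel S P)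
    (hbase : ∀ k, base k ∈ polSet S m) (R2 : ℕ → S → Fin n → Fin m → ℝ) (h : ℕ) (s : S) :
    Vstar2 H R R2 P base h s = maxminValue H (fun h s q p v => stagePayoff R2 P h s p q v)
      (fun _ _ => stdSimplex ℝ (Fin m)) (optimalChoices H R P base) (H + 1 - h) s := by
  rw [← (regularGame_attacker hn hm hK hP hbase R2).sSup_sInf_gameValue (Nat.sub_le _ _) s,
    ← Pi1starSet_eq_rectSet hn hK hP hbase]
  simp only [Vstar2, Vfun, valAux_eq_gameValue_swap]
  rfl

end Optimal


/-- attacker's worst-case Bellman equation: for every `h ∈ [H]`, `s ∈ S`,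
`V*_{2,h}(s) = max_{q∈Δ(m)} min_{p∈B*_h(s)} Σ_{a₁,a₂} p(a₁) q(a₂) Q*_{2,h}(s)[a₁,a₂]`,
where `B*_h(s) = {p ∈ Δ(n) : Σ_{a₁,a₂} p(a₁) πᵏ_{2,h}(s)(a₂) Q*_{1,h}(s)[a₁,a₂] ≥ V*_{1,h}(s) ∀ k}`
and `Q*_{i,h}(s)[a₁,a₂] = R_{i,h}(s,a₁,a₂) + Σ_{s'} P_h(s'|s,a₁,a₂) V*_{i,h+1}(s')`. -/
theorem stmt9 {S : Type} [Fintype S] {n m K H : ℕ} (hn : 0 < n) (hm : 0 < m) (hK : 0 < K)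
    (R1 R2 : ℕ → S → Fin n → Fin m → ℝ)
    (P : ℕ → S → Fin n → Fin m → S → ℝ) (hP : isKernel S P)
    (base : Fin K → ℕ → S → Fin m → ℝ) (hbase : ∀ k, base k ∈ polSet S m)
    (h : ℕ) (hh1 : 1 ≤ h) (hhH : h ≤ H) (s : S) :
    IsGreatest
      ((fun q : Fin m → ℝ => sInf ((fun p : Fin n → ℝ =>
          ∑ a1, ∑ a2, p a1 * q a2 *
            (R2 h s a1 a2 + ∑ s', P h s a1 a2 s' * Vstar2 H R1 R2 P base (h + 1) s')) ''
        {p ∈ stdSimplex ℝ (Fin n) | ∀ k : Fin K,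
          Vstar1 H R1 P base h s ≤ ∑ a1, ∑ a2, p a1 * base k h s a2 *
            (R1 h s a1 a2 + ∑ s', P h s a1 a2 s' * Vstar1 H R1 P base (h + 1) s')})) ''
        stdSimplex ℝ (Fin m))
      (Vstar2 H R1 R2 P base h s) := by
  have hV := fun t => funext (Vstar2_eq_maxminValue (R := R1) (H := H) hn hm hK hP hbase R2 t)
  have key := (regularGame_attacker (R := R1) (H := H) hn hm hK hP hbase
    R2).isGreatest_maxminValue_succ H (H - h) s
  rw [Nat.sub_sub_self hhH] at key
  rw [hV h, hV (h + 1), Nat.succ_sub hhH, Nat.add_sub_add_right]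
  simp only [stageInf, optimalChoices, if_pos (And.intro hh1 hhH)] at key
  exact key
end
end

section
/- (Reward design for dominant-policy inception.) In a finite-horizon two-player Markov game, fix ι > 0 and a deterministic attacker policy π† : [H] × S → [m], and define the fake attacker reward R†_{2,h}(s,a₁,a₂) := ι · ((H−h+1)(H−h+2)/2) · 𝟙[a₂ = π†_h(s)]. Let V†^{π₁,π₂}_{2,h}(s) denote the attacker value computed with reward R†₂ (via the backward value recursion). Then for every victim Markov policy π₁, every attacker Markov policy π₂, every h ∈ [H], and every s ∈ S: V†^{π₁,π†}_{2,h}(s) − V†^{π₁,π₂}_{2,h}(s) ≥ ι · (1 − π_{2,h}(s)(π†_h(s))). In particular, π† maximizes the attacker's fake value against every π₁, with a gap of at least ι whenever π₂ deviates deterministically from π† at (h,s). -/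
open Finset

noncomputable section

/-- The fake attacker reward
`R†_{2,h}(s,a₁,a₂) = ι · ((H−h+1)(H−h+2)/2) · 𝟙[a₂ = π†_h(s)]`. -/
def Rdag {S : Type} (n m H : ℕ) (ι : ℝ) (πd : ℕ → S → Fin m) :
    ℕ → S → Fin n → Fin m → ℝ :=
  fun h s _ a2 =>
    if a2 = πd h s then ι * (((H - h + 1) * (H - h + 2) : ℕ) : ℝ) / 2 else 0

/-- The expectation of `w · 𝟙[a₂ = b] + c` under a product of two distributions. -/
theorem sum_sum_indicator_add_const {n m : ℕ} {p : Fin n → ℝ} {q : Fin m → ℝ}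
    (hp : p ∈ stdSimplex ℝ (Fin n)) (hq : q ∈ stdSimplex ℝ (Fin m)) (b : Fin m) (w c : ℝ) :
    ∑ a1, ∑ a2, p a1 * q a2 * ((if a2 = b then w else 0) + c) = q b * w + c := by
  have h : ∑ a2, q a2 * ((if a2 = b then w else 0) + c) = q b * w + c := by
    simp only [mul_add, Finset.sum_add_distrib, ← Finset.sum_mul, hq.2]
    simp
  simp only [mul_assoc, ← Finset.mul_sum, h]
  rw [← Finset.sum_mul, hp.2, one_mul]

theorem Rdag_sub {S : Type} {n m H : ℕ} (ι : ℝ) (πd : ℕ → S → Fin m) {t : ℕ} (ht : t ≤ H)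
    (s : S) (a1 : Fin n) (a2 : Fin m) :
    Rdag n m H ι πd (H - t) s a1 a2 =
      if a2 = πd (H - t) s then ι * ((t + 1) * (t + 2)) / 2 else 0 := by
  simp [Rdag, Nat.sub_sub_self ht]

/-- One backward step of the fake value when the continuation value is at most `c`. -/
theorem valAux_Rdag_succ_le {S : Type} [Fintype S] {n m H : ℕ}
    {P : ℕ → S → Fin n → Fin m → S → ℝ} (hP : isKernel S P)
    (ι : ℝ) (πd : ℕ → S → Fin m) {π1 : ℕ → S → Fin n → ℝ} (h1 : π1 ∈ polSet S n)
    {π2 : ℕ → S → Fin m → ℝ} (h2 : π2 ∈ polSet S m) {t : ℕ} (ht : t ≤ H) {c : ℝ}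
    (hc : ∀ s, valAux H (Rdag n m H ι πd) P π1 π2 t s ≤ c) (s : S) :
    valAux H (Rdag n m H ι πd) P π1 π2 (t + 1) s ≤
      π2 (H - t) s (πd (H - t) s) * (ι * ((t + 1) * (t + 2)) / 2) + c := by
  rw [valAux, ← sum_sum_indicator_add_const (h1 (H - t) s) (h2 (H - t) s)]
  refine Finset.sum_le_sum fun a1 _ => Finset.sum_le_sum fun a2 _ => ?_
  rw [Rdag_sub ι πd ht]
  refine mul_le_mul_of_nonneg_left ?_ (mul_nonneg ((h1 _ s).1 a1) ((h2 _ s).1 a2))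
  gcongr
  calc ∑ s', P (H - t) s a1 a2 s' * valAux H (Rdag n m H ι πd) P π1 π2 t s'
      ≤ ∑ s', P (H - t) s a1 a2 s' * c :=
        Finset.sum_le_sum fun s' _ => mul_le_mul_of_nonneg_left (hc s') ((hP _ s a1 a2).1 s')
    _ = c := by rw [← Finset.sum_mul, (hP _ s a1 a2).2, one_mul]

/-- The largest fake value with `t` steps to go is `ι t (t + 1) (t + 2) / 6`. -/
theorem valAux_Rdag_le {S : Type} [Fintype S] {n m H : ℕ}
    {P : ℕ → S → Fin n → Fin m → S → ℝ} (hP : isKernel S P)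
    {ι : ℝ} (hι : 0 < ι) (πd : ℕ → S → Fin m) {π1 : ℕ → S → Fin n → ℝ} (h1 : π1 ∈ polSet S n)
    {π2 : ℕ → S → Fin m → ℝ} (h2 : π2 ∈ polSet S m) (t : ℕ) (ht : t ≤ H) (s : S) :
    valAux H (Rdag n m H ι πd) P π1 π2 t s ≤ ι * (t * (t + 1) * (t + 2)) / 6 := by
  induction t generalizing s with
  | zero => simp [valAux]
  | succ t ih =>
    have ht' : t ≤ H := by omega
    refine (valAux_Rdag_succ_le hP ι πd h1 h2 ht' (ih ht') s).trans ?_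
    have hq : π2 (H - t) s (πd (H - t) s) ≤ 1 :=
      (mem_Icc_of_mem_stdSimplex (h2 (H - t) s) _).2
    have hw : 0 ≤ ι * (((t : ℝ) + 1) * (t + 2)) / 2 := by positivity
    have := mul_le_mul_of_nonneg_right hq hw
    push_cast
    linarith

/-- The policy `π†` attains the largest fake value. -/
theorem valAux_Rdag_deterministic {S : Type} [Fintype S] {n m H : ℕ}
    {P : ℕ → S → Fin n → Fin m → S → ℝ} (hP : isKernel S P)
    (ι : ℝ) (πd : ℕ → S → Fin m) {π1 : ℕ → S → Fin n → ℝ} (h1 : π1 ∈ polSet S n)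
    (t : ℕ) (ht : t ≤ H) (s : S) :
    valAux H (Rdag n m H ι πd) P π1 (fun h' s' a2 => if a2 = πd h' s' then (1 : ℝ) else 0) t s =
      ι * (t * (t + 1) * (t + 2)) / 6 := by
  induction t generalizing s with
  | zero => simp [valAux]
  | succ t ih =>
    have ht' : t ≤ H := by omega
    have hq : (fun a2 => if a2 = πd (H - t) s then (1 : ℝ) else 0) ∈ stdSimplex ℝ (Fin m) :=
      ⟨fun a2 => by positivity, by simp⟩
    simp only [valAux, ih ht', ← Finset.sum_mul, (hP _ _ _ _).2, one_mul, Rdag_sub ι πd ht']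
    rw [sum_sum_indicator_add_const (h1 (H - t) s) hq, if_pos rfl]
    push_cast
    ring

/-- reward design for dominant-policy inception: for the fake reward
`R†₂`, the deterministic policy `π†` dominates: for every victim policy `π₁`, every
attacker policy `π₂`, every `h ∈ [H]` and `s ∈ S`,
`V†^{π₁,π†}_{2,h}(s) − V†^{π₁,π₂}_{2,h}(s) ≥ ι · (1 − π_{2,h}(s)(π†_h(s)))`. -/
theorem stmt12 {S : Type} [Fintype S] {n m H : ℕ} (hn : 0 < n) (hm : 0 < m)
    (P : ℕ → S → Fin n → Fin m → S → ℝ) (hP : isKernel S P)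
    (ι : ℝ) (hι : 0 < ι) (πd : ℕ → S → Fin m) :
    ∀ π1 ∈ polSet S n, ∀ π2 ∈ polSet S m, ∀ h : ℕ, 1 ≤ h → h ≤ H → ∀ s : S,
      ι * (1 - π2 h s (πd h s)) ≤
        Vfun H (Rdag n m H ι πd) P π1
            (fun h' s' a2 => if a2 = πd h' s' then (1 : ℝ) else 0) h s
          - Vfun H (Rdag n m H ι πd) P π1 π2 h s := by
  intro π1 h1 π2 h2 h hh hH s
  obtain ⟨t, rfl⟩ : ∃ t, h = H - t := ⟨H - h, by omega⟩
  have ht : t + 1 ≤ H := by omega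
  have hs : H + 1 - (H - t) = t + 1 := by omega
  have ht' : t ≤ H := by omega
  rw [Vfun, Vfun, hs, valAux_Rdag_deterministic hP ι πd h1 (t + 1) ht s]
  have hle := valAux_Rdag_succ_le hP ι πd h1 h2 ht' (valAux_Rdag_le hP hι πd h1 h2 t ht') s
  have hq : π2 (H - t) s (πd (H - t) s) ≤ 1 :=
    (mem_Icc_of_mem_stdSimplex (h2 (H - t) s) _).2
  have hw : ι ≤ ι * (((t : ℝ) + 1) * (t + 2)) / 2 := by
    have h0 : (0 : ℝ) ≤ t := t.cast_nonneg
    have : (0 : ℝ) ≤ ι * (t * (t + 3)) := by positivity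
    linarith
  have hgap := mul_le_mul_of_nonneg_right hw (sub_nonneg.2 hq)
  push_cast
  linarith
end
end

section
/- (Reward–policy reduction for normal-form inception.) Let A, B ∈ ℝ^{n×m} and ι > 0. For ŷ ∈ Δ(m) let BR_A(ŷ) := {x ∈ Δ(n) : xᵀA ŷ = max_{x'∈Δ(n)} x'ᵀA ŷ}. Then: sup over all pairs (B†, y†) with B† ∈ ℝ^{n×m} and y† ∈ Δ(m) ι-strictly dominant for B†, of the quantity max_{y∈Δ(m)} min_{x∈BR_A(y†)} xᵀB y, equals max_{j∈[m]} max_{y∈Δ(m)} min_{x∈BR_A(e_j)} xᵀB y; moreover the supremum is attained (in particular, for every j ∈ [m] there exists B† for which e_j is ι-strictly dominant). -/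
open Finset

noncomputable section

/-- The `j`-th pure strategy `e_j`. -/
def pure (m : ℕ) (j : Fin m) : Fin m → ℝ := fun j' => if j' = j then 1 else 0

/-- The victim's best-response set `BR_A(ŷ) = {x ∈ Δ(n) : xᵀ A ŷ = max_{x'∈Δ(n)} x'ᵀ A ŷ}`. -/
def BRset {n m : ℕ} (A : Matrix (Fin n) (Fin m) ℝ) (yd : Fin m → ℝ) : Set (Fin n → ℝ) :=
  {x ∈ stdSimplex ℝ (Fin n) | ∀ x' ∈ stdSimplex ℝ (Fin n), pay A x' yd ≤ pay A x yd}

/-- `y*` is `ι`-strictly dominant for `B†`: `xᵀ B† y* ≥ xᵀ B† e_j + ι` for all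
`x ∈ Δ(n)` and all pure strategies `e_j ≠ y*`. -/
def StrictlyDominant {n m : ℕ} (Bd : Matrix (Fin n) (Fin m) ℝ) (ι : ℝ)
    (ystar : Fin m → ℝ) : Prop :=
  ∀ x ∈ stdSimplex ℝ (Fin n), ∀ j : Fin m,
    pure m j ≠ ystar → pay Bd x (pure m j) + ι ≤ pay Bd x ystar

/-- The attacker's worst-case value `max_{y∈Δ(m)} min_{x∈BR_A(ŷ)} xᵀ B y` when the
victim best-responds to the believed strategy `ŷ`. -/
def gval {n m : ℕ} (A B : Matrix (Fin n) (Fin m) ℝ) (yd : Fin m → ℝ) : ℝ :=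
  sSup ((fun y => sInf ((fun x => pay B x y) '' BRset A yd)) '' stdSimplex ℝ (Fin m))

theorem pay_pure {n m : ℕ} (A : Matrix (Fin n) (Fin m) ℝ) (x : Fin n → ℝ) (j : Fin m) :
    pay A x (pure m j) = ∑ i, x i * A i j := by
  simp [pay, _root_.pure]

theorem pay_eq_sum_pay_pure {n m : ℕ} (A : Matrix (Fin n) (Fin m) ℝ) (x : Fin n → ℝ)
    (y : Fin m → ℝ) : pay A x y = ∑ j, y j * pay A x (pure m j) := by
  simp only [pay_pure, Finset.mul_sum]
  rw [pay, Finset.sum_comm]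
  exact Finset.sum_congr rfl fun j _ => Finset.sum_congr rfl fun i _ => by ring

theorem pure_mem_stdSimplex {m : ℕ} (j : Fin m) : pure m j ∈ stdSimplex ℝ (Fin m) := by
  refine ⟨fun k => ?_, by simp [_root_.pure]⟩
  unfold _root_.pure
  split_ifs <;> norm_num

/-- A strictly dominant mixed strategy is pure: its payoff is an average of pure payoffs, so it
cannot exceed all of them by a positive margin. -/
theorem StrictlyDominant.exists_eq_pure {n m : ℕ} (hn : 0 < n) {Bd : Matrix (Fin n) (Fin m) ℝ}
    {ι : ℝ} (hι : 0 < ι) {y : Fin m → ℝ} (hy : y ∈ stdSimplex ℝ (Fin m))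
    (h : StrictlyDominant Bd ι y) : ∃ j, pure m j = y := by
  by_contra! hne
  have hx := pure_mem_stdSimplex (⟨0, hn⟩ : Fin n)
  set x := pure n ⟨0, hn⟩
  have hle : ∑ j, y j * pay Bd x (pure m j) ≤ ∑ j, y j * (pay Bd x y - ι) :=
    Finset.sum_le_sum fun j _ =>
      mul_le_mul_of_nonneg_left (by linarith [h x hx j (hne j)]) (hy.1 j)
  rw [← pay_eq_sum_pay_pure, ← Finset.sum_mul, hy.2] at hle
  linarith

/-- Rewarding only the column `j` makes the pure strategy `e_j` strictly dominant. -/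
theorem exists_strictlyDominant_pure (n : ℕ) {m : ℕ} (ι : ℝ) (j : Fin m) :
    ∃ Bd : Matrix (Fin n) (Fin m) ℝ, StrictlyDominant Bd ι (pure m j) := by
  refine ⟨Matrix.of fun _ k => if k = j then ι else 0, fun x hx k hk => ?_⟩
  have hkj : k ≠ j := fun e => hk (e ▸ rfl)
  simp [pay_pure, hkj, ← Finset.sum_mul, hx.2]

/-- reward–policy reduction for normal-form inception: the supremum over
all pairs `(B†, y†)`, with `y†` `ι`-strictly dominant for `B†`, of
`max_{y∈Δ(m)} min_{x∈BR_A(y†)} xᵀ B y`, is attained and equals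
`max_{j∈[m]} max_{y∈Δ(m)} min_{x∈BR_A(e_j)} xᵀ B y`. -/
theorem stmt13 {n m : ℕ} (hn : 0 < n) (hm : 0 < m)
    (A B : Matrix (Fin n) (Fin m) ℝ) (ι : ℝ) (hι : 0 < ι) :
    ∃ jstar : Fin m,
      IsGreatest {v : ℝ | ∃ (Bd : Matrix (Fin n) (Fin m) ℝ) (yd : Fin m → ℝ),
          yd ∈ stdSimplex ℝ (Fin m) ∧ StrictlyDominant Bd ι yd ∧ v = gval A B yd}
        (gval A B (pure m jstar)) ∧
      ∀ j : Fin m, gval A B (pure m j) ≤ gval A B (pure m jstar) := by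
  have : Nonempty (Fin m) := ⟨⟨0, hm⟩⟩
  obtain ⟨jstar, hmax⟩ := Finite.exists_max fun j => gval A B (pure m j)
  refine ⟨jstar, ⟨?_, ?_⟩, hmax⟩
  · obtain ⟨Bd, hBd⟩ := exists_strictlyDominant_pure n ι jstar
    exact ⟨Bd, pure m jstar, pure_mem_stdSimplex jstar, hBd, rfl⟩
  · rintro v ⟨Bd, yd, hyd, hdom, rfl⟩
    obtain ⟨j, rfl⟩ := hdom.exists_eq_pure hn hι hyd
    exact hmax j
end
end
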